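/- There exist α ∈ (0,1) and a function C₄ of two real variables such that: for every F ∈ C²(T⁵) satisfying the normalization (N) ∫_{[0,1]⁵}(e^F − 1) dx = 0, and every φ ∈ C⁴(T⁵) with ∫_{[−1/2,1/2]⁵} φ = 0 solving equation (★), one has ‖φ‖_{C^{2,α}} ≤ C₄(‖F‖_{C²}, ‖φ‖_{C⁰}). -/

import Mathlib

open MeasureTheory

/-- Partial derivative in the `i`-th coordinate direction. -/
noncomputable def pd {n : ℕ} (i : Fin n) (f : (Fin n → ℝ) → ℝ) : (Fin n → ℝ) → ℝ :=
  fun x => fderiv ℝ f x (Pi.single i 1)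

/-- Second partial derivative `∂²f/∂x^i∂x^j`. -/
noncomputable def pd2 {n : ℕ} (i j : Fin n) (f : (Fin n → ℝ) → ℝ) : (Fin n → ℝ) → ℝ :=
  pd i (pd j f)

/-- A function on `ℝⁿ` that is `1`-periodic in every coordinate, i.e. a function on `Tⁿ`. -/
def PeriodicPi {n : ℕ} (f : (Fin n → ℝ) → ℝ) : Prop :=
  ∀ x : Fin n → ℝ, ∀ i : Fin n, f (x + Pi.single i 1) = f x

/-- The Euclidean Laplacian. -/
noncomputable def lap {n : ℕ} (f : (Fin n → ℝ) → ℝ) : (Fin n → ℝ) → ℝ :=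
  fun x => ∑ i, pd2 i i f x

/-- Equation (★): the reduction of the quaternionic Monge–Ampère equation to `T⁵`. -/
def EqStar (F φ : (Fin 5 → ℝ) → ℝ) : Prop :=
  ∀ x : Fin 5 → ℝ,
    (pd2 0 0 φ x + pd2 1 1 φ x + pd2 2 2 φ x + pd2 3 3 φ x + 1) * (pd2 4 4 φ x + 1)
      - (pd2 0 4 φ x) ^ 2 - (pd2 1 4 φ x) ^ 2 - (pd2 2 4 φ x) ^ 2 - (pd2 3 4 φ x) ^ 2
      = Real.exp (F x)

/-- Iterated partial derivative `∂^I f` for a multi-index `I`. -/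
noncomputable def pdI {n : ℕ} (I : Fin n → ℕ) (f : (Fin n → ℝ) → ℝ) : (Fin n → ℝ) → ℝ :=
  (List.finRange n).foldr (fun i g => (pd i)^[I i] g) f

/-- The `Cᵏ`-norm `max_{|I| ≤ k} sup_x |∂^I f(x)|`. -/
noncomputable def CNorm {n : ℕ} (k : ℕ) (f : (Fin n → ℝ) → ℝ) : ℝ :=
  ⨆ I : Fin n → ℕ, ⨆ _ : (∑ i, I i) ≤ k, ⨆ x : Fin n → ℝ, |pdI I f x|

/-- The Euclidean norm of a vector in `ℝⁿ`. -/
noncomputable def eucNorm {n : ℕ} (v : Fin n → ℝ) : ℝ :=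
  Real.sqrt (∑ i, (v i) ^ 2)

/-- The Hölder seminorm `|f|_{C^{k,α}} = max_{|I|=k} sup_x sup_{0<|h|≤1}
`|∂^I f(x+h) − ∂^I f(x)|/|h|^α`. -/
noncomputable def holderSemi {n : ℕ} (k : ℕ) (α : ℝ) (f : (Fin n → ℝ) → ℝ) : ℝ :=
  ⨆ I : Fin n → ℕ, ⨆ _ : (∑ i, I i) = k, ⨆ x : Fin n → ℝ, ⨆ h : Fin n → ℝ,
    ⨆ _ : 0 < eucNorm h ∧ eucNorm h ≤ 1,
      |pdI I f (x + h) - pdI I f x| / (eucNorm h) ^ α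

/-- The `C^{k,α}`-norm. -/
noncomputable def CAlphaNorm {n : ℕ} (k : ℕ) (α : ℝ) (f : (Fin n → ℝ) → ℝ) : ℝ :=
  max (CNorm k f) (holderSemi k α f)

variable {n : ℕ}

/-- The `k`-th standard basis vector. -/
abbrev bvec (k : Fin n) : Fin n → ℝ := Pi.single k 1

theorem hasDerivAt_line {f : (Fin n → ℝ) → ℝ} (hf : Differentiable ℝ f) (x v : Fin n → ℝ) (τ : ℝ) :
    HasDerivAt (fun τ : ℝ => f (x + τ • v)) (fderiv ℝ f (x + τ • v) v) τ := by
  have h1 : HasDerivAt (fun τ : ℝ => x + τ • v) v τ := by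
    simpa using ((hasDerivAt_id τ).smul_const v).const_add x
  exact (hf (x + τ • v)).hasFDerivAt.comp_hasDerivAt τ h1

theorem hasDerivAt_coord {f : (Fin n → ℝ) → ℝ} (hf : Differentiable ℝ f) (k : Fin n)
    (x : Fin n → ℝ) (τ : ℝ) :
    HasDerivAt (fun τ : ℝ => f (x + τ • bvec k)) (pd k f (x + τ • bvec k)) τ :=
  hasDerivAt_line hf x _ τ

theorem contDiff_pd {m m' : WithTop ℕ∞} {f : (Fin n → ℝ) → ℝ} (hf : ContDiff ℝ m f) (k : Fin n)
    (h : m' + 1 ≤ m) : ContDiff ℝ m' (pd k f) :=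
  (hf.fderiv_right h).clm_apply contDiff_const

theorem pd_comm {f : (Fin n → ℝ) → ℝ} (hf : ContDiff ℝ 2 f) (i j : Fin n) :
    pd i (pd j f) = pd j (pd i f) := by
  funext x
  have hd : Differentiable ℝ (fderiv ℝ f) :=
    (hf.fderiv_right (m := 1) (by norm_num)).differentiable (by norm_num)
  have h (i j : Fin n) : pd i (pd j f) x = fderiv ℝ (fderiv ℝ f) x (bvec i) (bvec j) := by
    unfold pd
    rw [fderiv_clm_apply (hd x) (differentiableAt_const _)]
    simp
  rw [h, h]
  exact (hf.contDiffAt.isSymmSndFDerivAt (by simp)) _ _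

theorem pd_sub {f g : (Fin n → ℝ) → ℝ} (hf : Differentiable ℝ f) (hg : Differentiable ℝ g)
    (k : Fin n) : pd k (fun x => f x - g x) = fun x => pd k f x - pd k g x := by
  funext x
  simp only [pd]
  rw [fderiv_fun_sub (hf x) (hg x)]
  simp

theorem pd_sum {ι : Type*} (s : Finset ι) {f : ι → (Fin n → ℝ) → ℝ}
    (hf : ∀ i ∈ s, Differentiable ℝ (f i)) (k : Fin n) :
    pd k (fun x => ∑ i ∈ s, f i x) = fun x => ∑ i ∈ s, pd k (f i) x := by
  funext x
  simp only [pd]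
  rw [fderiv_fun_sum (fun i hi => hf i hi x)]
  simp

/-- The necessary second-order condition at a local maximum on the line. -/
theorem second_deriv_nonpos_of_isLocalMax {g g' : ℝ → ℝ} {c t : ℝ} (hg : ∀ τ, HasDerivAt g (g' τ) τ)
    (hg' : HasDerivAt g' c t) (hmax : IsLocalMax g t) : c ≤ 0 := by
  by_contra! hc
  have hd : deriv g = g' := funext fun τ => (hg τ).deriv
  have h0 : deriv g t = 0 := hmax.deriv_eq_zero
  have hmin : IsLocalMin g t :=
    isLocalMin_of_deriv_deriv_pos (by rw [hd, hg'.deriv]; exact hc) h0 (hg t).continuousAt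
  have hconst : g =ᶠ[nhds t] fun _ => g t := by
    filter_upwards [hmax, hmin] with y h1 h2 using le_antisymm h1 h2
  have h1 : g' =ᶠ[nhds t] fun _ => 0 := by
    have := hconst.deriv
    rw [hd] at this
    simpa using this
  have h2 := hg'.congr_of_eventuallyEq h1.symm
  exact hc.ne' (h2.unique (hasDerivAt_const t (0 : ℝ)))

theorem second_deriv_nonneg_of_isLocalMin {g g' : ℝ → ℝ} {c t : ℝ} (hg : ∀ τ, HasDerivAt g (g' τ) τ)
    (hg' : HasDerivAt g' c t) (hmin : IsLocalMin g t) : 0 ≤ c := by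
  have := second_deriv_nonpos_of_isLocalMax (g := fun τ => -g τ) (fun τ => (hg τ).neg) hg'.neg hmin.neg
  linarith

/-- The Hessian is nonpositive at a maximum, tested on a combination of two coordinate vectors. -/
theorem pd2_combination_nonpos_of_max {f : (Fin n → ℝ) → ℝ} (hf : ContDiff ℝ 2 f) {x : Fin n → ℝ}
    (hx : ∀ y, f y ≤ f x) (i j : Fin n) (c : ℝ) :
    pd2 i i f x + 2 * c * pd2 i j f x + c ^ 2 * pd2 j j f x ≤ 0 := by
  have hd : Differentiable ℝ f := hf.differentiable (by norm_num)
  have hdp (k : Fin n) : Differentiable ℝ (pd k f) :=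
    (contDiff_pd (m' := 1) hf k (by norm_num)).differentiable (by norm_num)
  have hcomb (g : (Fin n → ℝ) → ℝ) (y : Fin n → ℝ) :
      fderiv ℝ g y (bvec i + c • bvec j) = pd i g y + c * pd j g y := by
    simp [pd]
  have h1 (τ : ℝ) : HasDerivAt (fun τ : ℝ => f (x + τ • (bvec i + c • bvec j)))
      (pd i f (x + τ • (bvec i + c • bvec j)) + c * pd j f (x + τ • (bvec i + c • bvec j))) τ := by
    rw [← hcomb]; exact hasDerivAt_line hd x _ τ
  have h2 := (hasDerivAt_line (hdp i) x (bvec i + c • bvec j) 0).add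
    ((hasDerivAt_line (hdp j) x (bvec i + c • bvec j) 0).const_mul c)
  have h3 := second_deriv_nonpos_of_isLocalMax h1 h2
    (Filter.Eventually.of_forall fun τ => by simpa using hx _)
  rw [hcomb, hcomb] at h3
  have h4 : pd j (pd i f) x = pd i (pd j f) x := by rw [pd_comm hf]
  simp only [zero_smul, add_zero, h4] at h3
  simp only [pd2]
  linarith

theorem pd2_nonpos_of_max {f : (Fin n → ℝ) → ℝ} (hf : ContDiff ℝ 2 f) {x : Fin n → ℝ}
    (hx : ∀ y, f y ≤ f x) (i : Fin n) : pd2 i i f x ≤ 0 := by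
  simpa using pd2_combination_nonpos_of_max hf hx i i 0

namespace PeriodicPi

variable {f : (Fin n → ℝ) → ℝ}

theorem add_int_smul (hf : PeriodicPi f) (x : Fin n → ℝ) (i : Fin n) (m : ℤ) :
    f (x + (m : ℝ) • bvec i) = f x := by
  have h : Function.Periodic (fun τ : ℝ => f (x + τ • bvec i)) 1 := fun τ => by
    simpa [add_smul, ← add_assoc] using hf (x + τ • bvec i) i
  simpa using h.int_mul m 0

theorem add_int (hf : PeriodicPi f) (x : Fin n → ℝ) (m : Fin n → ℤ) :
    f (x + fun i => (m i : ℝ)) = f x := by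
  have key (s : Finset (Fin n)) : f (x + ∑ i ∈ s, (m i : ℝ) • bvec i) = f x := by
    induction s using Finset.induction_on with
    | empty => simp
    | insert a s ha ih => rw [Finset.sum_insert ha, add_comm (_ • _), ← add_assoc, hf.add_int_smul, ih]
  have h := key Finset.univ
  rwa [← pi_eq_sum_univ'] at h

theorem fract (hf : PeriodicPi f) (x : Fin n → ℝ) : f (fun i => Int.fract (x i)) = f x := by
  have h := hf.add_int (fun i => Int.fract (x i)) (fun i => ⌊x i⌋)
  rw [← h]
  congr 1
  funext i
  simp [Int.fract_add_floor]

theorem exists_max (hf : PeriodicPi f) (hc : Continuous f) : ∃ x, ∀ y, f y ≤ f x := by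
  obtain ⟨x, -, hx⟩ := (isCompact_Icc (a := (0 : Fin n → ℝ)) (b := 1)).exists_isMaxOn
    ⟨0, by simp⟩ hc.continuousOn
  refine ⟨x, fun y => ?_⟩
  rw [← hf.fract y]
  exact hx ⟨fun i => Int.fract_nonneg _, fun i => (Int.fract_lt_one _).le⟩

protected theorem pd (hf : PeriodicPi f) (k : Fin n) : PeriodicPi (pd k f) := fun x i => by
  have h : (fun y => f (y + bvec i)) = f := funext fun y => hf y i
  unfold _root_.pd
  rw [← fderiv_comp_add_right, h]

theorem exists_abs_le (hf : PeriodicPi f) (hc : Continuous f) : ∃ C, ∀ x, |f x| ≤ C := by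
  have hp : PeriodicPi fun x => |f x| := fun x i => by simp only [hf x i]
  obtain ⟨x, hx⟩ := hp.exists_max hc.abs
  exact ⟨_, hx⟩

end PeriodicPi

theorem abs_sub_le_of_pd_le {f : (Fin n → ℝ) → ℝ} (hf : Differentiable ℝ f) {k : Fin n} {C : ℝ}
    (hC : ∀ x, |pd k f x| ≤ C) (x : Fin n → ℝ) {r : ℝ} (hr : 0 ≤ r) :
    |f (x + r • bvec k) - f x| ≤ C * r := by
  have h := Convex.norm_image_sub_le_of_norm_hasDerivWithin_le (s := Set.univ) (C := C)
    (fun τ _ => (hasDerivAt_coord hf k x τ).hasDerivWithinAt) (fun τ _ => hC _) convex_univ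
    (Set.mem_univ 0) (Set.mem_univ r)
  simpa [abs_of_nonneg hr] using h

/-- A bound on increments along coordinate directions bounds all increments. -/
theorem abs_sub_le_of_coord {f : (Fin n → ℝ) → ℝ} {ω : ℝ → ℝ} (hω : Monotone ω)
    (h : ∀ (k : Fin n) (x : Fin n → ℝ) (r : ℝ), 0 ≤ r → |f (x + r • bvec k) - f x| ≤ ω r)
    (x y : Fin n → ℝ) : |f y - f x| ≤ n * ω ‖y - x‖ := by
  have h' (k : Fin n) (x : Fin n → ℝ) (r : ℝ) : |f (x + r • bvec k) - f x| ≤ ω |r| := by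
    rcases le_total 0 r with hr | hr
    · rw [abs_of_nonneg hr]; exact h k x r hr
    · have := h k (x + r • bvec k) (-r) (by linarith)
      rw [abs_of_nonpos hr, abs_sub_comm]
      simpa [add_assoc] using this
  have key (s : Finset (Fin n)) :
      |f (x + ∑ i ∈ s, (y - x) i • bvec i) - f x| ≤ s.card * ω ‖y - x‖ := by
    induction s using Finset.induction_on with
    | empty => simp
    | insert a s ha ih =>
      rw [Finset.sum_insert ha, add_comm (_ • _), ← add_assoc, Finset.card_insert_of_notMem ha]
      have h1 := h' a (x + ∑ i ∈ s, (y - x) i • bvec i) ((y - x) a)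
      have h2 : ω |(y - x) a| ≤ ω ‖y - x‖ := hω (norm_le_pi_norm (y - x) a)
      have h3 := abs_sub_le (f (x + ∑ i ∈ s, (y - x) i • bvec i + (y - x) a • bvec a))
        (f (x + ∑ i ∈ s, (y - x) i • bvec i)) (f x)
      push_cast
      linarith
  have h1 := key Finset.univ
  rw [← pi_eq_sum_univ'] at h1
  simpa using h1

/-- A derivative of a periodic function vanishes somewhere on every unit coordinate segment. -/
theorem PeriodicPi.exists_pd_eq_zero {f : (Fin n → ℝ) → ℝ} (hp : PeriodicPi f)
    (hf : Differentiable ℝ f) (k : Fin n) (x : Fin n → ℝ) :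
    ∃ τ ∈ Set.Ioo (0 : ℝ) 1, pd k f (x + τ • bvec k) = 0 :=
  exists_hasDerivAt_eq_zero one_pos
    (fun τ _ => (hasDerivAt_coord hf k x τ).continuousAt.continuousWithinAt)
    (by simpa using (hp x k).symm) (fun τ _ => hasDerivAt_coord hf k x τ)

theorem exists_list_pdI_eq (I : Fin n → ℕ) (f : (Fin n → ℝ) → ℝ) :
    ∃ l : List (Fin n), l.length = ∑ i, I i ∧ pdI I f = l.foldr pd f := by
  have hrep (i : Fin n) (m : ℕ) (g : (Fin n → ℝ) → ℝ) :
      (pd i)^[m] g = (List.replicate m i).foldr pd g := by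
    induction m with
    | zero => rfl
    | succ m ih => rw [Function.iterate_succ_apply', ih]; rfl
  have key (s : List (Fin n)) : ∃ l : List (Fin n), l.length = (s.map I).sum ∧
      s.foldr (fun i g => (pd i)^[I i] g) f = l.foldr pd f := by
    induction s with
    | nil => exact ⟨[], rfl, rfl⟩
    | cons a s ih =>
      obtain ⟨l, h1, h2⟩ := ih
      exact ⟨List.replicate (I a) a ++ l, by simp [h1], by
        rw [List.foldr_cons, h2, hrep, List.foldr_append]⟩
  obtain ⟨l, h1, h2⟩ := key (List.finRange n)
  refine ⟨l, ?_, h2⟩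
  rw [h1, Fin.sum_univ_def]

theorem contDiff_foldr_pd {f : (Fin n → ℝ) → ℝ} (l : List (Fin n)) (m : ℕ)
    (hf : ContDiff ℝ (l.length + m : ℕ) f) : ContDiff ℝ m (l.foldr pd f) := by
  induction l generalizing m with
  | nil => simpa using hf
  | cons a l ih =>
    refine contDiff_pd (ih (m + 1) ?_) a (by norm_cast)
    convert hf using 2
    simp only [List.length_cons]
    omega

theorem PeriodicPi.foldr_pd {f : (Fin n → ℝ) → ℝ} (hf : PeriodicPi f) (l : List (Fin n)) :
    PeriodicPi (l.foldr pd f) := by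
  induction l with
  | nil => exact hf
  | cons a l ih => exact ih.pd a

theorem finite_setOf_sum_le (k : ℕ) : {I : Fin n → ℕ | ∑ i, I i ≤ k}.Finite :=
  (Set.finite_Iic (fun _ : Fin n => k)).subset fun _ hI i =>
    (Finset.single_le_sum (fun _ _ => Nat.zero_le _) (Finset.mem_univ i)).trans hI

theorem abs_pdI_le_CNorm {k : ℕ} {f : (Fin n → ℝ) → ℝ} (hf : ContDiff ℝ k f) (hp : PeriodicPi f)
    {I : Fin n → ℕ} (hI : ∑ i, I i ≤ k) (x : Fin n → ℝ) : |pdI I f x| ≤ CNorm k f := by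
  have hb : BddAbove (Set.range fun x => |pdI I f x|) := by
    obtain ⟨l, hl, h⟩ := exists_list_pdI_eq I f
    have hc : ContDiff ℝ (0 : ℕ) (l.foldr pd f) :=
      contDiff_foldr_pd l 0 (hf.of_le (by rw [add_zero, hl]; exact_mod_cast hI))
    obtain ⟨C, hC⟩ := (hp.foldr_pd l).exists_abs_le hc.continuous
    exact ⟨C, by rintro _ ⟨x, rfl⟩; simpa only [h] using hC x⟩
  have hB : BddAbove (Set.range fun I : Fin n → ℕ => ⨆ _ : ∑ i, I i ≤ k, ⨆ x, |pdI I f x|) := by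
    have hfin := ((finite_setOf_sum_le (n := n) k).image
      fun I => ⨆ _ : ∑ i, I i ≤ k, ⨆ x, |pdI I f x|).insert 0
    refine hfin.bddAbove.mono ?_
    rintro _ ⟨J, rfl⟩
    by_cases hJ : ∑ i, J i ≤ k
    · exact Or.inr ⟨J, hJ, rfl⟩
    · left; simp [hJ]
  calc |pdI I f x| ≤ ⨆ x, |pdI I f x| := le_ciSup hb x
    _ = ⨆ _ : ∑ i, I i ≤ k, ⨆ x, |pdI I f x| := by simp [hI]
    _ ≤ _ := le_ciSup hB I

theorem CNorm_le {k : ℕ} {f : (Fin n → ℝ) → ℝ} {C : ℝ} (hC : 0 ≤ C)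
    (h : ∀ l : List (Fin n), l.length ≤ k → ∀ x, |l.foldr pd f x| ≤ C) : CNorm k f ≤ C := by
  refine Real.iSup_le (fun I => Real.iSup_le (fun hI => Real.iSup_le (fun x => ?_) hC) hC) hC
  obtain ⟨l, hl, hf⟩ := exists_list_pdI_eq I f
  rw [hf]
  exact h l (hl.trans_le hI) x

theorem holderSemi_le {k : ℕ} {α : ℝ} {f : (Fin n → ℝ) → ℝ} {C : ℝ} (hC : 0 ≤ C)
    (h : ∀ l : List (Fin n), l.length = k → ∀ x y, 0 < eucNorm y →
      |l.foldr pd f (x + y) - l.foldr pd f x| ≤ C * eucNorm y ^ α) : holderSemi k α f ≤ C := by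
  refine Real.iSup_le (fun I => Real.iSup_le (fun hI => Real.iSup_le (fun x => Real.iSup_le
    (fun y => Real.iSup_le (fun hy => ?_) hC) hC) hC) hC) hC
  obtain ⟨l, hl, hf⟩ := exists_list_pdI_eq I f
  rw [hf, div_le_iff₀ (Real.rpow_pos_of_pos hy.1 α)]
  exact h l (hl.trans hI) x y hy.1

theorem norm_le_eucNorm (v : Fin n → ℝ) : ‖v‖ ≤ eucNorm v := by
  refine (pi_norm_le_iff_of_nonneg (Real.sqrt_nonneg _)).2 fun i => Real.abs_le_sqrt ?_
  exact Finset.single_le_sum (f := fun i => v i ^ 2) (fun _ _ => sq_nonneg _) (Finset.mem_univ i)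

theorem pdI_zero (f : (Fin n → ℝ) → ℝ) : pdI 0 f = f := by
  obtain ⟨l, hl, h⟩ := exists_list_pdI_eq 0 f
  have : l = [] := by simpa using hl
  rw [h, this]; rfl

theorem pdI_single (k : Fin n) (m : ℕ) (f : (Fin n → ℝ) → ℝ) :
    pdI (Pi.single k m) f = (pd k)^[m] f := by
  have key (s : List (Fin n)) (hs : s.Nodup) :
      s.foldr (fun i g => (pd i)^[(Pi.single k m : Fin n → ℕ) i] g) f =
        if k ∈ s then (pd k)^[m] f else f := by
    induction s with
    | nil => rfl
    | cons a s ih =>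
      rw [List.nodup_cons] at hs
      rw [List.foldr_cons, ih hs.2]
      by_cases ha : a = k
      · subst ha; simp [hs.1]
      · simp [ha, Ne.symm ha]
  have h := key (List.finRange n) (List.nodup_finRange n)
  unfold pdI
  rw [h, if_pos (List.mem_finRange k)]

/-- Maximum principle with doubled variables: if `w` satisfies an elliptic inequality for the
differences of its second derivatives, its increments in a coordinate direction grow linearly. -/
theorem sub_le_of_elliptic_increment {w : (Fin n → ℝ) → ℝ} (hw : ContDiff ℝ 2 w)
    (hp : PeriodicPi w) {c : (Fin n → ℝ) → Fin n → ℝ} {l : ℝ} (hl : 0 < l) (hc : ∀ x j, l ≤ c x j)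
    {k : Fin n} {d M A Γ : ℝ} (hd : 0 < d) (hM : 0 ≤ M) (hΓM : Γ < 2 * l * M)
    (hΓ : ∀ x r, 0 < r → r < d →
      -Γ ≤ ∑ j, c x j * (pd2 j j w (x + r • bvec k) - pd2 j j w x))
    (hA : ∀ x, w (x + d • bvec k) - w x ≤ A) (x : Fin n → ℝ) {r : ℝ} (hr0 : 0 ≤ r) (hrd : r ≤ d) :
    w (x + r • bvec k) - w x ≤ r * (A / d + M * d / 2) := by
  set L := A / d + M * d / 2 with hL
  have hLd : L * d - M * d ^ 2 / 2 = A := by rw [hL]; field_simp; ring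
  have hwd : Differentiable ℝ w := hw.differentiable (by norm_num)
  have hpd (j : Fin n) : Differentiable ℝ (pd j w) :=
    (contDiff_pd (m' := 1) hw j (by norm_num)).differentiable (by norm_num)
  set f : (Fin n → ℝ) → ℝ → ℝ := fun x r => w (x + r • bvec k) - w x - (L * r - M * r ^ 2 / 2)
    with hf
  suffices h : f x r ≤ 0 by
    have h1 : f x r = w (x + r • bvec k) - w x - (L * r - M * r ^ 2 / 2) := rfl
    nlinarith [mul_nonneg hM (sq_nonneg r)]
  have hfc : Continuous fun q : (Fin n → ℝ) × ℝ => f q.1 q.2 := by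
    have := hw.continuous
    simp only [hf]
    fun_prop
  obtain ⟨⟨x₀, r₀⟩, ⟨-, hr₀⟩, hmax'⟩ :=
    ((isCompact_Icc (a := (0 : Fin n → ℝ)) (b := 1)).prod (isCompact_Icc (a := (0 : ℝ)) (b := d))).exists_isMaxOn
    ⟨(0, 0), by simp [hd.le]⟩ hfc.continuousOn
  have hmax (y : Fin n → ℝ) (s : ℝ) (hs : s ∈ Set.Icc 0 d) : f y s ≤ f x₀ r₀ := by
    have hper : PeriodicPi fun y => f y s := fun y i => by
      simp only [hf, hp y i, add_right_comm y _ (s • bvec k), hp (y + s • bvec k) i]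
    have h1 := hmax' (a := (fun i => Int.fract (y i), s))
      ⟨⟨fun i => Int.fract_nonneg _, fun i => (Int.fract_lt_one _).le⟩, hs⟩
    exact (hper.fract y).symm.le.trans h1
  refine (hmax x r ⟨hr0, hrd⟩).trans ?_
  by_contra! hpos
  have hr₀0 : r₀ ≠ 0 := by
    rintro rfl
    simp [hf] at hpos
  have hr₀d : r₀ ≠ d := by
    rintro rfl
    have := hA x₀
    simp only [hf] at hpos
    linarith
  have h0 : 0 < r₀ := lt_of_le_of_ne hr₀.1 (Ne.symm hr₀0)
  have h1 : r₀ < d := lt_of_le_of_ne hr₀.2 hr₀d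
  set y₀ := x₀ + r₀ • bvec k with hy₀
  have hne (j : Fin n) : pd2 j j w y₀ - pd2 j j w x₀ ≤ 0 := by
    have e1 (τ : ℝ) := (hasDerivAt_coord hwd j y₀ τ).sub (hasDerivAt_coord hwd j x₀ τ)
    have e2 := (hasDerivAt_coord (hpd j) j y₀ 0).sub (hasDerivAt_coord (hpd j) j x₀ 0)
    have e3 := second_deriv_nonpos_of_isLocalMax e1 e2 (Filter.Eventually.of_forall fun τ => by
      have := hmax (x₀ + τ • bvec j) r₀ hr₀
      simp only [hf, add_right_comm x₀ (τ • bvec j) (r₀ • bvec k), ← hy₀] at this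
      simp only [Pi.sub_apply, zero_smul, add_zero]
      linarith)
    simpa [pd2] using e3
  have hbar (s τ : ℝ) : HasDerivAt
      (fun τ : ℝ => L * (r₀ + s * τ) - M * (r₀ + s * τ) ^ 2 / 2)
      (L * s - M * (r₀ + s * τ) * s) τ := by
    have h : HasDerivAt (fun τ : ℝ => r₀ + s * τ) (s * 1) τ :=
      ((hasDerivAt_id τ).const_mul s).const_add r₀
    refine ((h.const_mul L).fun_sub (((h.fun_pow 2).const_mul M).div_const 2)).congr_deriv ?_
    push_cast
    ring
  have hbar' (s τ : ℝ) (hs : s ^ 2 = 1) : HasDerivAt (fun τ : ℝ => L * s - M * (r₀ + s * τ) * s)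
      (-M) τ := by
    have h : HasDerivAt (fun τ : ℝ => r₀ + s * τ) (s * 1) τ :=
      ((hasDerivAt_id τ).const_mul s).const_add r₀
    refine (((h.const_mul M).mul_const s).const_sub (L * s)).congr_deriv ?_
    linear_combination -M * hs
  have hnear (s : ℝ) : ∀ᶠ τ : ℝ in nhds 0, r₀ + s * τ ∈ Set.Icc 0 d := by
    have hc : ContinuousAt (fun τ : ℝ => r₀ + s * τ) 0 := by fun_prop
    exact hc.preimage_mem_nhds (by simpa only [mul_zero, add_zero] using Icc_mem_nhds h0 h1)
  have hky : pd2 k k w y₀ + M ≤ 0 := by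
    have e1 (τ : ℝ) := (hasDerivAt_coord hwd k y₀ τ).sub (hbar 1 τ)
    have e2 := (hasDerivAt_coord (hpd k) k y₀ 0).sub (hbar' 1 0 (by norm_num))
    have e3 := second_deriv_nonpos_of_isLocalMax e1 e2 (by
      filter_upwards [hnear 1] with τ hτ
      have := hmax x₀ _ hτ
      simp only [hf, one_mul, add_smul, ← add_assoc, ← hy₀] at this
      simp only [Pi.sub_apply, zero_smul, add_zero, one_mul]
      linarith)
    simpa [pd2] using e3
  have hkx : -pd2 k k w x₀ + M ≤ 0 := by
    have e1 (τ : ℝ) := (hasDerivAt_coord hwd k x₀ τ).neg.sub (hbar (-1) τ)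
    have e2 := (hasDerivAt_coord (hpd k) k x₀ 0).neg.sub (hbar' (-1) 0 (by norm_num))
    have e3 := second_deriv_nonpos_of_isLocalMax e1 e2 (by
      filter_upwards [hnear (-1)] with τ hτ
      have := hmax (x₀ + τ • bvec k) _ hτ
      have e4 : x₀ + τ • bvec k + (r₀ + -1 * τ) • bvec k = y₀ := by
        rw [hy₀, add_assoc, ← add_smul]; congr 2; ring
      simp only [hf, e4, ← hy₀] at this
      simp only [Pi.sub_apply, Pi.neg_apply, zero_smul, add_zero, mul_zero]
      linarith)
    simpa [pd2] using e3
  have hsum : ∑ j, c x₀ j * (pd2 j j w y₀ - pd2 j j w x₀) ≤ -(2 * l * M) := by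
    have hnonneg (j : Fin n) : 0 ≤ c x₀ j * (-(pd2 j j w y₀ - pd2 j j w x₀)) :=
      mul_nonneg (hl.le.trans (hc x₀ j)) (by linarith [hne j])
    have e1 := Finset.single_le_sum (fun j _ => hnonneg j) (Finset.mem_univ k)
    simp only [mul_neg, Finset.sum_neg_distrib] at e1
    nlinarith [hc x₀ k]
  linarith [hΓ x₀ r₀ h0 h1]

theorem abs_sub_le_of_elliptic_increment {w : (Fin n → ℝ) → ℝ} (hw : ContDiff ℝ 2 w)
    (hp : PeriodicPi w) {c : (Fin n → ℝ) → Fin n → ℝ} {l : ℝ} (hl : 0 < l) (hc : ∀ x j, l ≤ c x j)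
    {k : Fin n} {d M A Γ : ℝ} (hd : 0 < d) (hM : 0 ≤ M) (hΓM : Γ < 2 * l * M)
    (hΓ : ∀ x r, 0 < r → r < d →
      |∑ j, c x j * (pd2 j j w (x + r • bvec k) - pd2 j j w x)| ≤ Γ)
    (hA : ∀ x, |w (x + d • bvec k) - w x| ≤ A) (x : Fin n → ℝ) {r : ℝ} (hr0 : 0 ≤ r) (hrd : r ≤ d) :
    |w (x + r • bvec k) - w x| ≤ r * (A / d + M * d / 2) := by
  have hneg (j : Fin n) : pd2 j j (fun x => -w x) = fun x => -pd2 j j w x := by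
    have h (g : (Fin n → ℝ) → ℝ) : pd j (fun x => -g x) = fun x => -pd j g x := by
      funext x; simp [pd, fderiv_fun_neg]
    simp only [pd2, h]
  refine abs_le'.2 ⟨sub_le_of_elliptic_increment hw hp hl hc hd hM hΓM
    (fun x r h0 h1 => (abs_le.1 (hΓ x r h0 h1)).1) (fun x => (le_abs_self _).trans (hA x)) x hr0 hrd, ?_⟩
  have h := sub_le_of_elliptic_increment (k := k) (A := A) hw.neg
    (fun y i => by simp only [hp y i]) hl hc hd hM hΓM (fun x r h0 h1 => by
      have := (abs_le.1 (hΓ x r h0 h1)).2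
      rw [← neg_le_neg_iff, ← Finset.sum_neg_distrib] at this
      refine this.trans_eq (Finset.sum_congr rfl fun j _ => ?_)
      rw [hneg]; ring)
    (fun x => by linarith [(abs_le.1 (hA x)).1]) x hr0 hrd
  linarith

/-- The second difference of `f` with steps `u` and `v`. -/
def secondDiff (u v : Fin n → ℝ) (f : (Fin n → ℝ) → ℝ) : (Fin n → ℝ) → ℝ :=
  fun x => f (x + u + v) - f (x + u) - f (x + v) + f x

theorem pd_secondDiff {f : (Fin n → ℝ) → ℝ} (hf : Differentiable ℝ f) (u v : Fin n → ℝ)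
    (k : Fin n) : pd k (secondDiff u v f) = secondDiff u v (pd k f) := by
  funext x
  have ht (w y : Fin n → ℝ) : HasFDerivAt (fun x => f (x + w)) (fderiv ℝ f (y + w)) y :=
    (hasFDerivAt_comp_add_right w).2 (hf (y + w)).hasFDerivAt
  have h := (((ht (u + v) x).fun_sub (ht u x)).fun_sub (ht v x)).fun_add (hf x).hasFDerivAt
  simp only [← add_assoc] at h
  unfold pd secondDiff
  rw [h.fderiv]
  rfl

theorem ContDiff.secondDiff {m : WithTop ℕ∞} {f : (Fin n → ℝ) → ℝ} (hf : ContDiff ℝ m f)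
    (u v : Fin n → ℝ) : ContDiff ℝ m (secondDiff u v f) := by
  have ht (w : Fin n → ℝ) : ContDiff ℝ m (fun x => f (x + w)) := hf.comp (contDiff_id.add contDiff_const)
  have h := (((ht (u + v)).sub (ht u)).sub (ht v)).add hf
  simp only [← add_assoc] at h
  exact h

theorem PeriodicPi.secondDiff {f : (Fin n → ℝ) → ℝ} (hf : PeriodicPi f) (u v : Fin n → ℝ) :
    PeriodicPi (secondDiff u v f) := fun x i => by
  have h (w : Fin n → ℝ) : f (x + bvec i + w) = f (x + w) := by
    rw [add_right_comm]; exact hf _ i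
  simp only [_root_.secondDiff, add_assoc _ u v, h, hf x i]

theorem exists_secondDiff_eq {f : (Fin n → ℝ) → ℝ} (hf : ContDiff ℝ 2 f) (i j : Fin n)
    (x : Fin n → ℝ) {R : ℝ} (hR : 0 < R) : ∃ s ∈ Set.Ioo 0 R, ∃ t ∈ Set.Ioo 0 R,
      secondDiff (R • bvec i) (R • bvec j) f x = R ^ 2 * pd2 i j f (x + s • bvec j + t • bvec i) := by
  have hd : Differentiable ℝ f := hf.differentiable (by norm_num)
  have hdj : Differentiable ℝ (pd j f) :=
    (contDiff_pd (m' := 1) hf j (by norm_num)).differentiable (by norm_num)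
  have h1 (τ : ℝ) := (hasDerivAt_coord hd j (x + R • bvec i) τ).fun_sub (hasDerivAt_coord hd j x τ)
  obtain ⟨s, hs, hs'⟩ := exists_hasDerivAt_eq_slope _ _ hR
    (fun τ _ => (h1 τ).continuousAt.continuousWithinAt) (fun τ _ => h1 τ)
  have h2 (τ : ℝ) := hasDerivAt_coord hdj i (x + s • bvec j) τ
  obtain ⟨t, ht, ht'⟩ := exists_hasDerivAt_eq_slope _ _ hR
    (fun τ _ => (h2 τ).continuousAt.continuousWithinAt) (fun τ _ => h2 τ)
  refine ⟨s, hs, t, ht, ?_⟩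
  rw [pd2, ht', secondDiff]
  rw [add_right_comm x (R • bvec i) (s • bvec j)] at hs'
  simp only [zero_smul, add_zero, sub_zero] at hs' ⊢
  rw [hs']
  field_simp
  ring

/-- The second derivatives of `f` have coordinate increments bounded by `N * √r`. -/
def HessianIncrementLE (f : (Fin n → ℝ) → ℝ) (N : ℝ) : Prop :=
  ∀ (i j m : Fin n) (x : Fin n → ℝ) (r : ℝ), 0 ≤ r →
    |pd2 i j f (x + r • bvec m) - pd2 i j f x| ≤ N * √r

theorem abs_secondDiff_sub_le {f : (Fin n → ℝ) → ℝ} (hf : ContDiff ℝ 2 f) {N : ℝ}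
    (hN : 0 ≤ N) (h : HessianIncrementLE f N) (i j : Fin n) (x : Fin n → ℝ) {R : ℝ} (hR : 0 < R) :
    |secondDiff (R • bvec i) (R • bvec j) f x - R ^ 2 * pd2 i j f x| ≤ R ^ 2 * (2 * N * √R) := by
  obtain ⟨s, hs, t, ht, e⟩ := exists_secondDiff_eq hf i j x hR
  rw [e, ← mul_sub, abs_mul, abs_of_nonneg (sq_nonneg R)]
  gcongr
  have h1 := h i j j x s hs.1.le
  have h2 := h i j i (x + s • bvec j) t ht.1.le
  have h3 : N * √s ≤ N * √R := by gcongr; exact hs.2.le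
  have h4 : N * √t ≤ N * √R := by gcongr; exact ht.2.le
  have h5 := abs_sub_le (pd2 i j f (x + s • bvec j + t • bvec i)) (pd2 i j f (x + s • bvec j))
    (pd2 i j f x)
  linarith

/-- The perturbation step of the Schauder estimate: an approximately constant right-hand side for
the operators with frozen coefficients improves any Hölder bound on the Hessian. -/
theorem HessianIncrementLE.improve {f : (Fin n → ℝ) → ℝ} (hf : ContDiff ℝ 3 f) (hp : PeriodicPi f)
    {c : (Fin n → ℝ) → Fin n → ℝ} {b : (Fin n → ℝ) → ℝ} {l K : ℝ} (hl : 0 < l) (hK : 0 < K)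
    (hc : ∀ x j, l ≤ c x j)
    (hb : ∀ x z, |∑ j, c x j * pd2 j j f z - b x| ≤ K * ‖z - x‖) {N : ℝ} (hN : 0 ≤ N)
    (h : HessianIncrementLE f N) : HessianIncrementLE f (N / 2 + 1090519040 * K / l) := by
  have hf2 : ContDiff ℝ 2 f := hf.of_le (by norm_num)
  have hd : Differentiable ℝ f := hf.differentiable (by norm_num)
  have hdp (j : Fin n) : Differentiable ℝ (pd j f) :=
    (contDiff_pd (m' := 1) hf j (by norm_num)).differentiable (by norm_num)
  have hbv (m : Fin n) (r : ℝ) (hr : 0 ≤ r) : ‖r • bvec m‖ = r := by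
    rw [norm_smul, Pi.norm_single]; simp [abs_of_nonneg hr]
  suffices hs : ∀ (i j m : Fin n) (x : Fin n → ℝ) (σ : ℝ), 0 < σ → σ ≤ 1 →
      |pd2 i j f (x + σ ^ 2 • bvec m) - pd2 i j f x| ≤ (N / 2 + 1090519040 * K / l) * σ by
    intro i j m x r hr
    have hper : PeriodicPi (pd2 i j f) := (hp.pd j).pd i
    have e : pd2 i j f (x + r • bvec m) = pd2 i j f (x + Int.fract r • bvec m) := by
      have h1 := hper.add_int_smul (x + Int.fract r • bvec m) m ⌊r⌋
      rw [← h1, add_assoc, ← add_smul, Int.fract_add_floor]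
    have hC : 0 ≤ N / 2 + 1090519040 * K / l := by positivity
    rw [e]
    rcases (Int.fract_nonneg r).eq_or_lt with h0 | h0
    · rw [← h0]; simp; positivity
    · have h1 := hs i j m x (√(Int.fract r)) (Real.sqrt_pos.2 h0)
        (Real.sqrt_le_one.2 (Int.fract_lt_one r).le)
      rw [Real.sq_sqrt h0.le] at h1
      refine h1.trans ?_
      gcongr
      linarith [Int.floor_nonneg.2 hr, Int.fract_add_floor r,
        (Int.cast_nonneg (R := ℝ) (Int.floor_nonneg.2 hr))]
  intro i j m x σ hσ hσ1
  set R := σ ^ 2 / 256 with hR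
  set d := 64 * σ ^ 2 with hdd
  have hR0 : 0 < R := by positivity
  have hd0 : 0 < d := by positivity
  have hsR : √R = σ / 16 := by
    rw [show R = (σ / 16) ^ 2 by rw [hR]; ring, Real.sqrt_sq (by positivity)]
  have hsd : √d = 8 * σ := by
    rw [show d = (8 * σ) ^ 2 by rw [hdd]; ring, Real.sqrt_sq (by positivity)]
  set w := secondDiff (R • bvec i) (R • bvec j) f with hw
  have happ (x : Fin n → ℝ) : |w x - R ^ 2 * pd2 i j f x| ≤ R ^ 2 * (N * σ / 8) := by
    have := abs_secondDiff_sub_le hf2 hN h i j x hR0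
    rw [hsR] at this
    refine this.trans_eq ?_
    ring
  have hpdw (k : Fin n) : pd2 k k w = secondDiff (R • bvec i) (R • bvec j) (pd2 k k f) := by
    simp only [pd2, hw]
    rw [pd_secondDiff hd, pd_secondDiff (hdp k)]
  have hA (y : Fin n → ℝ) : |w (y + d • bvec m) - w y| ≤ R ^ 2 * (N * σ * (33 / 4)) := by
    have h1 := h i j m y d hd0.le
    rw [hsd] at h1
    have h2 : |R ^ 2 * (pd2 i j f (y + d • bvec m) - pd2 i j f y)| ≤ R ^ 2 * (N * (8 * σ)) := by
      rw [abs_mul, abs_of_nonneg (sq_nonneg R)]; gcongr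
    have h3 := happ y
    have h4 := happ (y + d • bvec m)
    rw [abs_le] at h2 h3 h4 ⊢
    constructor <;> linarith
  have hop (y z : Fin n → ℝ) (hz : ‖z - y‖ ≤ d) :
      |∑ k, c y k * pd2 k k w z| ≤ 260 * K * σ ^ 2 := by
    have h1 (v : Fin n → ℝ) (hv : ‖v‖ ≤ 2 * R) :
        |∑ k, c y k * pd2 k k f (z + v) - b y| ≤ 65 * K * σ ^ 2 := by
      have e1 := norm_add_le (z - y) v
      have e2 : z + v - y = z - y + v := by abel
      have e3 : ‖z + v - y‖ ≤ 65 * σ ^ 2 := by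
        rw [e2]
        have : (0 : ℝ) < σ ^ 2 := by positivity
        linarith
      have e4 := (hb y (z + v)).trans (mul_le_mul_of_nonneg_left e3 hK.le)
      linarith
    have e : ∑ k, c y k * pd2 k k w z =
        (∑ k, c y k * pd2 k k f (z + (R • bvec i + R • bvec j)) - b y)
        - (∑ k, c y k * pd2 k k f (z + R • bvec i) - b y)
        - (∑ k, c y k * pd2 k k f (z + R • bvec j) - b y)
        + (∑ k, c y k * pd2 k k f (z + 0) - b y) := by
      simp only [hpdw, secondDiff, mul_add, mul_sub, Finset.sum_add_distrib,
        Finset.sum_sub_distrib, ← add_assoc, add_zero]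
      ring
    have g1 := h1 (R • bvec i + R • bvec j) ((norm_add_le _ _).trans (by
      rw [hbv i R hR0.le, hbv j R hR0.le]; linarith))
    have g2 := h1 (R • bvec i) (by rw [hbv i R hR0.le]; linarith)
    have g3 := h1 (R • bvec j) (by rw [hbv j R hR0.le]; linarith)
    have g4 := h1 0 (by simpa using hR0.le)
    rw [e]
    rw [abs_le] at g1 g2 g3 g4 ⊢
    constructor <;> linarith
  have hKσ : 0 < K * σ ^ 2 := by positivity
  have hmain := abs_sub_le_of_elliptic_increment (w := w) (k := m) (c := c) (l := l) (d := d)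
    (M := 520 * K * σ ^ 2 / l) (Γ := 520 * K * σ ^ 2) (hf2.secondDiff _ _) (hp.secondDiff _ _)
    hl hc hd0 (by positivity) (by field_simp; norm_num)
    (fun y r hr0 hrd => by
      have g1 := hop y (y + r • bvec m) (by rw [add_sub_cancel_left, hbv m r hr0.le]; exact hrd.le)
      have g2 := hop y y (by simpa using hd0.le)
      simp only [mul_sub, Finset.sum_sub_distrib]
      rw [abs_le] at g1 g2 ⊢
      constructor <;> linarith)
    hA x (sq_nonneg σ) (by rw [hdd]; nlinarith)
  have h3 := happ x
  have h4 := happ (x + σ ^ 2 • bvec m)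
  have h5 : σ ^ 2 * (R ^ 2 * (N * σ * (33 / 4)) / d + 520 * K * σ ^ 2 / l * d / 2)
      = R ^ 2 * (N * σ * (33 / 256) + 1090519040 * K / l * σ ^ 2) := by
    rw [hdd, hR]; field_simp; ring
  rw [h5] at hmain
  have h6 : |R ^ 2 * (pd2 i j f (x + σ ^ 2 • bvec m) - pd2 i j f x)| ≤
      R ^ 2 * ((N / 2 + 1090519040 * K / l) * σ) := by
    have e1 : 1090519040 * K / l * σ ^ 2 ≤ 1090519040 * K / l * σ := by
      gcongr; nlinarith
    have e2 : R ^ 2 * (N * σ * (97 / 256) + 1090519040 * K / l * σ ^ 2) ≤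
        R ^ 2 * ((N / 2 + 1090519040 * K / l) * σ) := by
      gcongr
      nlinarith [mul_nonneg hN hσ.le]
    refine le_trans ?_ e2
    rw [abs_le] at hmain h3 h4 ⊢
    constructor <;> linarith
  rw [abs_mul, abs_of_nonneg (sq_nonneg R)] at h6
  exact le_of_mul_le_mul_left h6 (by positivity)

/-- Schauder estimate for periodic functions, for operators with only second-order terms. -/
theorem hessianIncrementLE_of_elliptic {f : (Fin n → ℝ) → ℝ} (hf : ContDiff ℝ 3 f)
    (hp : PeriodicPi f) {c : (Fin n → ℝ) → Fin n → ℝ} {b : (Fin n → ℝ) → ℝ} {l K : ℝ} (hl : 0 < l)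
    (hK : 0 < K) (hc : ∀ x j, l ≤ c x j)
    (hb : ∀ x z, |∑ j, c x j * pd2 j j f z - b x| ≤ K * ‖z - x‖) :
    HessianIncrementLE f (2 * (1090519040 * K / l) + 1) := by
  have hdp (i j : Fin n) : ContDiff ℝ 1 (pd2 i j f) :=
    contDiff_pd (contDiff_pd (m' := 2) hf j (by norm_num)) i (by norm_num)
  have hp2 (i j : Fin n) : PeriodicPi (pd2 i j f) := (hp.pd j).pd i
  choose B hB using fun q : Fin n × Fin n =>
    (hp2 q.1 q.2).exists_abs_le (hdp q.1 q.2).continuous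
  choose L hL using fun q : Fin n × Fin n × Fin n =>
    ((hp2 q.1 q.2.1).pd q.2.2).exists_abs_le
      (contDiff_pd (m' := 0) (hdp q.1 q.2.1) q.2.2 (by norm_num)).continuous
  obtain ⟨B', hB'⟩ := (Set.finite_range B).bddAbove
  obtain ⟨L', hL'⟩ := (Set.finite_range L).bddAbove
  set N₀ := max 0 (max L' (2 * B')) with hN₀
  have h0 : HessianIncrementLE f N₀ := by
    intro i j m x r hr
    have h1 (y : Fin n → ℝ) : |pd2 i j f y| ≤ B' := (hB (i, j) y).trans (hB' ⟨(i, j), rfl⟩)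
    have h2 (y : Fin n → ℝ) : |pd m (pd2 i j f) y| ≤ L' :=
      (hL (i, j, m) y).trans (hL' ⟨(i, j, m), rfl⟩)
    have h3 : L' ≤ N₀ := (le_max_left _ _).trans (le_max_right _ _)
    have h4 : 2 * B' ≤ N₀ := (le_max_right _ _).trans (le_max_right _ _)
    have h5 : 0 ≤ N₀ := le_max_left _ _
    rcases le_total r 1 with hr1 | hr1
    · calc _ ≤ L' * r := abs_sub_le_of_pd_le ((hdp i j).differentiable (by norm_num)) h2 x hr
        _ ≤ N₀ * √r := mul_le_mul h3 (Real.le_sqrt_of_sq_le (by nlinarith)) hr h5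
    · calc _ ≤ |pd2 i j f (x + r • bvec m)| + |pd2 i j f x| := abs_sub _ _
        _ ≤ N₀ := by linarith [h1 x, h1 (x + r • bvec m)]
        _ ≤ N₀ * √r := le_mul_of_one_le_right h5 (Real.one_le_sqrt.2 hr1)
  have hiter (k : ℕ) : HessianIncrementLE f (N₀ / 2 ^ k + 2 * (1090519040 * K / l)) := by
    have hC : 0 ≤ 2 * (1090519040 * K / l) := by positivity
    induction k with
    | zero =>
      intro i j m x r hr
      refine (h0 i j m x r hr).trans ?_
      gcongr
      simpa using hC
    | succ k ih =>
      have h1 := ih.improve hf hp hl hK hc hb (by positivity)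
      convert h1 using 1
      rw [pow_succ]
      ring
  obtain ⟨k, hk⟩ := pow_unbounded_of_one_lt N₀ (one_lt_two (α := ℝ))
  intro i j m x r hr
  have hk' : N₀ / 2 ^ k ≤ 1 := (div_le_one (by positivity)).2 hk.le
  refine (hiter k i j m x r hr).trans ?_
  gcongr ?_ * _
  linarith

/-- Reverse Cauchy–Schwarz inequality for the quadratic form `A * B - |c|²`. -/
theorem two_mul_le_lorentz {a₁ b₁ p₁ a₂ b₂ p₂ : ℝ} {c₁ c₂ : Fin 4 → ℝ} (ha₁ : 0 < a₁) (hb₁ : 0 < b₁)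
    (ha₂ : 0 < a₂) (hb₂ : 0 < b₂) (h₁ : a₁ * b₁ - ∑ i, c₁ i ^ 2 = p₁ ^ 2)
    (h₂ : a₂ * b₂ - ∑ i, c₂ i ^ 2 = p₂ ^ 2) :
    2 * (p₁ * p₂) ≤ b₁ * a₂ + a₁ * b₂ - 2 * ∑ i, c₁ i * c₂ i := by
  have hcs : (∑ i, c₁ i * c₂ i + p₁ * p₂) ^ 2 ≤ (∑ i, c₁ i ^ 2 + p₁ ^ 2) * (∑ i, c₂ i ^ 2 + p₂ ^ 2) := by
    have := Finset.sum_mul_sq_le_sq_mul_sq Finset.univ (Fin.snoc (α := fun _ => ℝ) c₁ p₁ : Fin 5 → ℝ)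
      (Fin.snoc (α := fun _ => ℝ) c₂ p₂ : Fin 5 → ℝ)
    simpa only [Fin.sum_univ_castSucc (n := 4), Fin.snoc_castSucc, Fin.snoc_last] using this
  have e₁ : ∑ i, c₁ i ^ 2 + p₁ ^ 2 = a₁ * b₁ := by linarith
  have e₂ : ∑ i, c₂ i ^ 2 + p₂ ^ 2 = a₂ * b₂ := by linarith
  rw [e₁, e₂] at hcs
  have h3 : (2 * (∑ i, c₁ i * c₂ i + p₁ * p₂)) ^ 2 ≤ (b₁ * a₂ + a₁ * b₂) ^ 2 := by
    nlinarith [sq_nonneg (b₁ * a₂ - a₁ * b₂)]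
  have h4 := abs_le_of_sq_le_sq h3 (by positivity)
  linarith [(abs_le.1 h4).2]

theorem sum_castSucc_four (g : Fin 5 → ℝ) : ∑ i : Fin 4, g i.castSucc = g 0 + g 1 + g 2 + g 3 := by
  rw [Fin.sum_univ_four]; rfl

/-- The trace of a nonpositive matrix against a nonnegative one is nonpositive, for matrices
of the shape occurring in the linearization of the equation. -/
theorem trace_nonpos {X Y s : ℝ} {c z d : Fin 4 → ℝ} (hY : 0 < Y) (hXY : ∑ i, c i ^ 2 ≤ X * Y)
    (hs : s ≤ 0) (h : ∀ i t, d i + 2 * t * z i + t ^ 2 * s ≤ 0) :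
    Y * ∑ i, d i + X * s - 2 * ∑ i, c i * z i ≤ 0 := by
  have h1 (i : Fin 4) : Y * d i - 2 * (c i * z i) + c i ^ 2 * (s / Y) ≤ 0 := by
    have h2 := mul_nonpos_of_nonneg_of_nonpos hY.le (h i (-c i / Y))
    have h3 : Y * (d i + 2 * (-c i / Y) * z i + (-c i / Y) ^ 2 * s) =
      Y * d i - 2 * (c i * z i) + c i ^ 2 * (s / Y) := by field_simp; ring
    linarith
  have h4 := Finset.sum_nonpos fun i (_ : i ∈ Finset.univ) => h1 i
  simp only [Finset.sum_add_distrib, Finset.sum_sub_distrib, ← Finset.mul_sum,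
    ← Finset.sum_mul] at h4
  have h5 : X * Y * (s / Y) ≤ (∑ i, c i ^ 2) * (s / Y) :=
    mul_le_mul_of_nonpos_right hXY (div_nonpos_of_nonpos_of_nonneg hs hY.le)
  have h6 : X * Y * (s / Y) = X * s := by field_simp
  linarith

section Equation

variable {F φ : (Fin 5 → ℝ) → ℝ}

theorem EqStar.mul_sub_sum (h : EqStar F φ) (x : Fin 5 → ℝ) :
    (pd2 0 0 φ x + pd2 1 1 φ x + pd2 2 2 φ x + pd2 3 3 φ x + 1) * (pd2 4 4 φ x + 1)
      - ∑ i : Fin 4, pd2 i.castSucc 4 φ x ^ 2 = Real.exp (F x / 2) ^ 2 := by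
  have e : Real.exp (F x / 2) ^ 2 = Real.exp (F x) := by
    rw [← Real.exp_nat_mul]; congr 1; push_cast; ring
  rw [e, ← h x, sum_castSucc_four fun i => pd2 i 4 φ x ^ 2]
  ring

theorem contDiff_pd2 {n : ℕ} {m m' : WithTop ℕ∞} {f : (Fin n → ℝ) → ℝ} (hf : ContDiff ℝ m f)
    (i j : Fin n) (h : m' + 1 + 1 ≤ m) : ContDiff ℝ m' (pd2 i j f) :=
  contDiff_pd (contDiff_pd hf j h) i le_rfl

theorem EqStar.pos (h : EqStar F φ) (hφ : ContDiff ℝ 4 φ) (hp : PeriodicPi φ) (x : Fin 5 → ℝ) :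
    0 < pd2 4 4 φ x + 1 := by
  have hc : Continuous fun x => pd2 4 4 φ x + 1 :=
    (contDiff_pd2 (m' := 2) hφ 4 4 (by norm_num)).continuous.add continuous_const
  have hne (y : Fin 5 → ℝ) : pd2 4 4 φ y + 1 ≠ 0 := fun h0 => by
    have h1 := h.mul_sub_sum y
    rw [h0, mul_zero] at h1
    have h2 : 0 ≤ ∑ i : Fin 4, pd2 i.castSucc 4 φ y ^ 2 := Finset.sum_nonneg fun _ _ => sq_nonneg _
    have h3 : 0 < Real.exp (F y / 2) ^ 2 := by positivity
    linarith
  obtain ⟨z, hz⟩ := PeriodicPi.exists_max (f := fun x => -φ x) (fun x i => by simp only [hp x i])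
    hφ.continuous.neg
  have hz1 : 0 < pd2 4 4 φ z + 1 := by
    have h1 := pd2_nonpos_of_max (f := fun x => -φ x) (hφ.neg.of_le (by norm_num)) hz 4
    have h2 (g : (Fin 5 → ℝ) → ℝ) : pd 4 (fun x => -g x) = fun x => -pd 4 g x := by
      funext x; simp [pd, fderiv_fun_neg]
    simp only [pd2, h2] at h1 ⊢
    linarith
  by_contra! hx
  obtain ⟨y, hy⟩ := mem_range_of_exists_le_of_exists_ge hc ⟨x, hx⟩ ⟨z, hz1.le⟩
  exact hne y hy

theorem EqStar.pos' (h : EqStar F φ) (hφ : ContDiff ℝ 4 φ) (hp : PeriodicPi φ) (x : Fin 5 → ℝ) :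
    0 < pd2 0 0 φ x + pd2 1 1 φ x + pd2 2 2 φ x + pd2 3 3 φ x + 1 := by
  have h1 := h.mul_sub_sum x
  have h2 : 0 ≤ ∑ i : Fin 4, pd2 i.castSucc 4 φ x ^ 2 := Finset.sum_nonneg fun _ _ => sq_nonneg _
  have h3 : 0 < Real.exp (F x / 2) ^ 2 := by positivity
  exact pos_of_mul_pos_left (by linarith) (h.pos hφ hp x).le

/-- Second-order consequence of the concavity of the equation: the linearized operator at `x`
applied to `∂²φ/∂x^k∂x^k` is bounded below. -/
theorem EqStar.linearized_pd2_ge (h : EqStar F φ) (hF : ContDiff ℝ 2 F) (hφ : ContDiff ℝ 4 φ)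
    (hp : PeriodicPi φ) (x : Fin 5 → ℝ) (k : Fin 5) :
    Real.exp (F x) * pd2 k k F x ≤
      (pd2 4 4 φ x + 1) * (pd2 k k (pd2 0 0 φ) x + pd2 k k (pd2 1 1 φ) x + pd2 k k (pd2 2 2 φ) x
        + pd2 k k (pd2 3 3 φ) x)
      + (pd2 0 0 φ x + pd2 1 1 φ x + pd2 2 2 φ x + pd2 3 3 φ x + 1) * pd2 k k (pd2 4 4 φ) x
      - 2 * ∑ i : Fin 4, pd2 i.castSucc 4 φ x * pd2 k k (pd2 i.castSucc 4 φ) x := by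
  have hd2 (i j : Fin 5) : ContDiff ℝ 2 (pd2 i j φ) := contDiff_pd2 hφ i j (by norm_num)
  have hd (i j : Fin 5) (τ : ℝ) :=
    hasDerivAt_coord ((hd2 i j).differentiable (by norm_num)) k x τ
  have hd' (i j : Fin 5) :=
    hasDerivAt_coord ((contDiff_pd (m' := 1) (hd2 i j) k (by norm_num)).differentiable (by norm_num)) k x 0
  have hE (τ : ℝ) := ((hasDerivAt_coord (hF.differentiable (by norm_num)) k x τ).div_const 2).exp
  have hE' := (hE 0).fun_mul ((hasDerivAt_coord
    ((contDiff_pd (m' := 1) hF k (by norm_num)).differentiable (by norm_num)) k x 0).div_const 2)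
  set Y := pd2 4 4 φ x + 1
  set X := pd2 0 0 φ x + pd2 1 1 φ x + pd2 2 2 φ x + pd2 3 3 φ x + 1
  have e1 (τ : ℝ) := ((((((((hd 0 0 τ).fun_add (hd 1 1 τ)).fun_add (hd 2 2 τ)).fun_add
    (hd 3 3 τ)).add_const 1).const_mul Y).fun_add (((hd 4 4 τ).add_const 1).const_mul X)).fun_sub
    ((HasDerivAt.fun_sum fun (i : Fin 4) (_ : i ∈ Finset.univ) =>
      (hd i.castSucc 4 τ).const_mul (pd2 i.castSucc 4 φ x)).const_mul 2)).fun_sub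
    ((hE τ).const_mul (2 * Real.exp (F x / 2)))
  have e2 := (((((((hd' 0 0).fun_add (hd' 1 1)).fun_add (hd' 2 2)).fun_add
    (hd' 3 3)).const_mul Y).fun_add ((hd' 4 4).const_mul X)).fun_sub
    ((HasDerivAt.fun_sum fun (i : Fin 4) (_ : i ∈ Finset.univ) =>
      (hd' i.castSucc 4).const_mul (pd2 i.castSucc 4 φ x)).const_mul 2)).fun_sub
    (hE'.const_mul (2 * Real.exp (F x / 2)))
  have e3 := second_deriv_nonneg_of_isLocalMin e1 e2 (Filter.Eventually.of_forall fun τ => by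
    have h1 := h.mul_sub_sum x
    have h2 := h.mul_sub_sum (x + τ • bvec k)
    have h3 := two_mul_le_lorentz (h.pos' hφ hp x) (h.pos hφ hp x) (h.pos' hφ hp _)
      (h.pos hφ hp _) h1 h2
    simp only [zero_smul, add_zero]
    have h4 : ∑ i : Fin 4, pd2 i.castSucc 4 φ x * pd2 i.castSucc 4 φ x =
        ∑ i : Fin 4, pd2 i.castSucc 4 φ x ^ 2 := Finset.sum_congr rfl fun i _ => by ring
    rw [h4]
    linarith)
  simp only [zero_smul, add_zero] at e3
  have h5 : Real.exp (F x) = Real.exp (F x / 2) * Real.exp (F x / 2) := by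
    rw [← Real.exp_add]; congr 1; ring
  simp only [pd2] at e3 ⊢
  rw [h5]
  nlinarith [sq_nonneg (Real.exp (F x / 2) * pd k F x)]

theorem pd2_comm_pd2 {n : ℕ} {f : (Fin n → ℝ) → ℝ} (hf : ContDiff ℝ 4 f) (i j k : Fin n) :
    pd2 i j (pd2 k k f) = pd2 k k (pd2 i j f) := by
  have h1 (m : Fin n) : ContDiff ℝ 3 (pd m f) := contDiff_pd hf m (by norm_num)
  have h2 (m m' : Fin n) : ContDiff ℝ 2 (pd m (pd m' f)) := contDiff_pd (h1 m') m (by norm_num)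
  have h3 (m : Fin n) : ContDiff ℝ 2 (pd m f) := (h1 m).of_le (by norm_num)
  have h4 : ContDiff ℝ 2 f := hf.of_le (by norm_num)
  simp only [pd2]
  rw [pd_comm (h3 k) j k, pd_comm h4 j k, pd_comm (h2 k j) i k, pd_comm (h3 j) i k]

/-- Bound for the Laplacian in terms of the sup norm. -/
theorem EqStar.laplacian_le (h : EqStar F φ) (hF : ContDiff ℝ 2 F) (hφ : ContDiff ℝ 4 φ)
    (hp : PeriodicPi φ) {A B : ℝ} (hA : ∀ x, F x ≤ A) (hA2 : ∀ k x, -A ≤ pd2 k k F x)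
    (hA0 : 0 ≤ A) (hB : ∀ x, |φ x| ≤ B) (x : Fin 5 → ℝ) :
    (pd2 0 0 φ x + pd2 1 1 φ x + pd2 2 2 φ x + pd2 3 3 φ x + 1) + (pd2 4 4 φ x + 1) ≤
      (2 + 5 * A) * Real.exp A + 2 * B := by
  have hd2 (i j : Fin 5) : ContDiff ℝ 2 (pd2 i j φ) := contDiff_pd2 hφ i j (by norm_num)
  have hφ2 : ContDiff ℝ 2 φ := hφ.of_le (by norm_num)
  set Z : (Fin 5 → ℝ) → ℝ := fun y => ∑ k, pd2 k k φ y - φ y with hZ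
  have hZ2 : ContDiff ℝ 2 Z := (ContDiff.sum fun k _ => hd2 k k).sub hφ2
  have hZp : PeriodicPi Z := fun y i => by
    simp only [hZ, hp y i, pd2, ((hp.pd _).pd _) y i]
  have hZd (i j : Fin 5) : pd2 i j Z = fun y => ∑ k, pd2 k k (pd2 i j φ) y - pd2 i j φ y := by
    have hk (k : Fin 5) : ContDiff ℝ 1 (pd j (pd2 k k φ)) := contDiff_pd (hd2 k k) j (by norm_num)
    have e1 : pd j Z = fun y => ∑ k, pd j (pd2 k k φ) y - pd j φ y := by
      rw [hZ, pd_sub ((ContDiff.sum fun k _ => hd2 k k).differentiable (by norm_num))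
        (hφ2.differentiable (by norm_num)),
        pd_sum _ fun k _ => (hd2 k k).differentiable (by norm_num)]
    have hj : ContDiff ℝ 1 (pd j φ) := contDiff_pd hφ2 j (by norm_num)
    rw [pd2, e1, pd_sub ((ContDiff.sum fun k _ => hk k).differentiable (by norm_num))
        (hj.differentiable (by norm_num)),
        pd_sum _ fun k _ => (hk k).differentiable (by norm_num)]
    funext y
    simp only [← pd2_comm_pd2 hφ]
    rfl
  obtain ⟨z, hz⟩ := hZp.exists_max hZ2.continuous
  have hQ := h.mul_sub_sum z
  have htr := trace_nonpos (X := pd2 0 0 φ z + pd2 1 1 φ z + pd2 2 2 φ z + pd2 3 3 φ z + 1)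
    (c := fun i => pd2 i.castSucc 4 φ z) (h.pos hφ hp z)
    (by have := sq_nonneg (Real.exp (F z / 2)); linarith)
    (pd2_nonpos_of_max hZ2 hz 4)
    (fun i t => pd2_combination_nonpos_of_max hZ2 hz i.castSucc 4 t)
  have hlin (k : Fin 5) := h.linearized_pd2_ge hF hφ hp z k
  have hlow (k : Fin 5) : -(A * Real.exp A) ≤ Real.exp (F z) * pd2 k k F z := by
    have h1 : Real.exp (F z) ≤ Real.exp A := Real.exp_le_exp.2 (hA z)
    nlinarith [Real.exp_pos (F z), hA2 k z]
  have hexp : Real.exp (F z / 2) ^ 2 ≤ Real.exp A := by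
    rw [← Real.exp_nat_mul]
    exact Real.exp_le_exp.2 (by push_cast; linarith [hA z])
  have hmax : (pd2 0 0 φ z + pd2 1 1 φ z + pd2 2 2 φ z + pd2 3 3 φ z + 1) + (pd2 4 4 φ z + 1) ≤
      (2 + 5 * A) * Real.exp A := by
    have g (k : Fin 5) := (hlow k).trans (hlin k)
    have g0 := g 0
    have g1 := g 1
    have g2 := g 2
    have g3 := g 3
    have g4 := g 4
    simp only [hZd, Fin.sum_univ_four, Fin.sum_univ_five] at htr hQ g0 g1 g2 g3 g4
    have e0 : (Fin.castSucc 0 : Fin 5) = 0 := rfl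
    have e1 : (Fin.castSucc 1 : Fin 5) = 1 := rfl
    have e2 : (Fin.castSucc 2 : Fin 5) = 2 := rfl
    have e3 : (Fin.castSucc 3 : Fin 5) = 3 := rfl
    simp only [e0, e1, e2, e3] at htr hQ g0 g1 g2 g3 g4
    linarith
  have hxz := hz x
  simp only [hZ, Fin.sum_univ_five] at hxz
  have h1 := abs_le.1 (hB x)
  have h2 := abs_le.1 (hB z)
  linarith

end Equation


section PartialLegendre

variable {n : ℕ} {f : (Fin n → ℝ) → ℝ} {k : Fin n}

theorem injective_partialLegendre (hf : ContDiff ℝ 2 f) (hpos : ∀ x, 0 < pd2 k k f x + 1) :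
    Function.Injective fun x => x + pd k f x • bvec k := by
  intro x y hxy
  have hd : Differentiable ℝ (pd k f) :=
    (contDiff_pd (m' := 1) hf k (by norm_num)).differentiable (by norm_num)
  have hmono : StrictMono fun τ : ℝ => τ + pd k f (x + τ • bvec k) :=
    strictMono_of_hasDerivAt_pos
      (fun τ => (hasDerivAt_id τ).add (hasDerivAt_coord hd k x τ))
      fun τ => by have := hpos (x + τ • bvec k); rw [pd2] at this; linarith
  have hy : y = x + (pd k f x - pd k f y) • bvec k := by
    rw [sub_smul, ← add_sub_assoc]; exact eq_sub_of_add_eq hxy.symm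
  have h0 : pd k f x - pd k f y = 0 := by
    apply hmono.injective
    simp only [← hy]
    simp
  rw [hy, h0]
  simp

theorem surjective_partialLegendre (hf : ContDiff ℝ 1 f) (hp : PeriodicPi f) (z : Fin n → ℝ) :
    ∃ x, x + pd k f x • bvec k = z := by
  have hc : Continuous (pd k f) := (contDiff_pd (m' := 0) hf k (by norm_num)).continuous
  obtain ⟨C, hC⟩ := (hp.pd k).exists_abs_le hc
  obtain ⟨τ, hτ⟩ := mem_range_of_exists_le_of_exists_ge (c := (0 : ℝ))
    (f := fun τ : ℝ => τ + pd k f (z + τ • bvec k)) (by fun_prop)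
    ⟨-C, by linarith [(abs_le.1 (hC (z + (-C) • bvec k))).2]⟩
    ⟨C, by linarith [(abs_le.1 (hC (z + C • bvec k))).1]⟩
  refine ⟨z + τ • bvec k, ?_⟩
  simp only at hτ
  rw [add_assoc, ← add_smul, hτ]
  simp

/-- The inverse of the change of variables of the partial Legendre transform in the direction `k`. -/
theorem exists_partialLegendre_inverse (hf : ContDiff ℝ 4 f) (hp : PeriodicPi f)
    (hpos : ∀ x, 0 < pd2 k k f x + 1) :
    ∃ S : (Fin n → ℝ) → (Fin n → ℝ), ContDiff ℝ 3 S ∧ (∀ x, S (x + pd k f x • bvec k) = x) ∧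
      (∀ z, S z + pd k f (S z) • bvec k = z) ∧ ∀ h : (Fin n → ℝ) → ℝ, Differentiable ℝ h →
        ∀ i z, pd i (fun z => h (S z)) z =
          pd i h (S z) - pd2 i k f (S z) / (pd2 k k f (S z) + 1) * pd k h (S z) := by
  have hinj := injective_partialLegendre (hf.of_le (by norm_num)) hpos
  choose S hS using surjective_partialLegendre (k := k) (hf.of_le (by norm_num)) hp
  have hk : ContDiff ℝ 3 (pd k f) := contDiff_pd hf k (by norm_num)
  have hT : ContDiff ℝ 3 fun x => x + pd k f x • bvec k :=
    contDiff_id.add (hk.smul contDiff_const)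
  have hST (x) : S (x + pd k f x • bvec k) = x := hinj (hS _)
  have hval (x) : fderiv ℝ (pd k f) x (bvec k) = pd2 k k f x := rfl
  have hD (x) : ∃ e : (Fin n → ℝ) ≃L[ℝ] (Fin n → ℝ),
      HasFDerivAt (fun x => x + pd k f x • bvec k) (e : (Fin n → ℝ) →L[ℝ] (Fin n → ℝ)) x ∧
      ∀ v, e.symm v = v - (fderiv ℝ (pd k f) x v / (pd2 k k f x + 1)) • bvec k := by
    have hne := (hpos x).ne'
    refine ⟨ContinuousLinearEquiv.equivOfInverse
      (ContinuousLinearMap.id ℝ _ + (fderiv ℝ (pd k f) x).smulRight (bvec k))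
      (ContinuousLinearMap.id ℝ _ -
        ((pd2 k k f x + 1)⁻¹ • fderiv ℝ (pd k f) x).smulRight (bvec k)) (fun v => ?_) (fun v => ?_),
      ?_, fun v => ?_⟩
    · simp only [add_apply, sub_apply,
        ContinuousLinearMap.id_apply, ContinuousLinearMap.smulRight_apply,
        smul_apply, map_add, map_smul, hval, smul_eq_mul]
      match_scalars <;> field_simp
      ring
    · simp only [add_apply, sub_apply,
        ContinuousLinearMap.id_apply, ContinuousLinearMap.smulRight_apply,
        smul_apply, map_sub, map_smul, hval, smul_eq_mul]
      match_scalars <;> field_simp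
      ring
    · exact (hasFDerivAt_id x).add
        ((hk.differentiable (by norm_num) x).hasFDerivAt.smul_const (bvec k))
    · change v - ((pd2 k k f x + 1)⁻¹ * fderiv ℝ (pd k f) x v) • bvec k = _
      rw [div_eq_inv_mul]
  choose e he he' using hD
  have hSc : ContDiff ℝ 3 S := by
    refine contDiff_iff_contDiffAt.2 fun z => ?_
    have hstrict := (hT.contDiffAt (x := S z)).hasStrictFDerivAt' (he (S z)) (by norm_num)
    have hloc := (hT.contDiffAt (x := S z)).to_localInverse (he (S z)) (by norm_num)
    rw [hS z] at hloc
    refine hloc.congr_of_eventuallyEq ?_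
    have hev := hstrict.eventually_right_inverse
    rw [hS z] at hev
    filter_upwards [hev] with w hw
    exact hinj ((hS w).trans hw.symm)
  refine ⟨S, hSc, hST, hS, fun h hh i z => ?_⟩
  have hSd : HasFDerivAt S ((e (S z)).symm : (Fin n → ℝ) →L[ℝ] (Fin n → ℝ)) z :=
    HasFDerivAt.of_local_left_inverse hSc.continuous.continuousAt (he (S z))
      (Filter.Eventually.of_forall hS)
  have hcomp := (hh (S z)).hasFDerivAt.comp z hSd
  change fderiv ℝ (h ∘ S) z (bvec i) = _
  rw [hcomp.fderiv]
  simp only [ContinuousLinearMap.comp_apply, ContinuousLinearEquiv.coe_coe, he', map_sub, map_smul,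
    smul_eq_mul]
  rfl

/-- The partial Legendre transform of `f` in the direction `k`, with the quadratic part removed. -/
theorem exists_partialLegendre (hf : ContDiff ℝ 4 f) (hp : PeriodicPi f)
    (hpos : ∀ x, 0 < pd2 k k f x + 1) :
    ∃ (S : (Fin n → ℝ) → (Fin n → ℝ)) (ψ : (Fin n → ℝ) → ℝ), ContDiff ℝ 3 S ∧
      (∀ x, S (x + pd k f x • bvec k) = x) ∧
      (∀ h : (Fin n → ℝ) → ℝ, Differentiable ℝ h → ∀ i z, pd i (fun z => h (S z)) z =
          pd i h (S z) - pd2 i k f (S z) / (pd2 k k f (S z) + 1) * pd k h (S z)) ∧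
      ContDiff ℝ 3 ψ ∧ PeriodicPi ψ ∧
      ∀ i j z, pd2 i j ψ z =
        pd2 i k f (S z) * pd2 k j f (S z) / (pd2 k k f (S z) + 1) - pd2 i j f (S z) := by
  obtain ⟨S, hSc, hST, hS, hchain⟩ := exists_partialLegendre_inverse hf hp hpos
  have hk : ContDiff ℝ 3 (pd k f) := contDiff_pd hf k (by norm_num)
  have hSp (z i) : S (z + bvec i) = S z + bvec i := by
    have h1 : S z + bvec i + pd k f (S z + bvec i) • bvec k = z + bvec i := by
      rw [(hp.pd k) (S z) i, add_right_comm, hS]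
    rw [← h1, hST]
  have hf1 : Differentiable ℝ f := hf.differentiable (by norm_num)
  have hk1 : Differentiable ℝ (pd k f) := hk.differentiable (by norm_num)
  have hψ (i z) : pd i (fun z => -(pd k f (S z) ^ 2 / 2) - f (S z)) z = -pd i f (S z) := by
    have hpd (i x) : pd i (fun x => -(pd k f x ^ 2 / 2) - f x) x =
        -(pd k f x * pd2 i k f x) - pd i f x := by
      have h1 := ((((hk1 x).hasFDerivAt.pow 2).mul_const (1 / 2)).neg.sub (hf1 x).hasFDerivAt)
      have h2 : (fun x => -(pd k f x ^ 2 / 2) - f x) =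
          (-fun x => pd k f x ^ 2 * (1 / 2)) - f := by
        funext x; simp [div_eq_mul_inv]
      rw [pd, h2, h1.fderiv]
      simp [pd2, pd]
      ring
    rw [hchain (fun x => -(pd k f x ^ 2 / 2) - f x) (by fun_prop), hpd, hpd]
    have := (hpos (S z)).ne'
    field_simp
    ring
  refine ⟨S, fun z => -(pd k f (S z) ^ 2 / 2) - f (S z), hSc, hST, hchain, ?_, fun z i => ?_,
    fun i j z => ?_⟩
  · exact (((hk.comp hSc).pow 2).div_const 2).neg.sub ((hf.of_le (by norm_num)).comp hSc)
  · change -(pd k f (S (z + bvec i)) ^ 2 / 2) - f (S (z + bvec i)) = _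
    rw [hSp, hp (S z) i, hp.pd k (S z) i]
  · rw [pd2, funext (hψ j)]
    have h1 : pd i (fun z => -pd j f (S z)) z = -pd i (fun z => pd j f (S z)) z := by
      simp [pd, fderiv_fun_neg]
    rw [h1, hchain _ ((contDiff_pd (m' := 3) hf j (by norm_num)).differentiable (by norm_num))]
    simp only [pd2]
    ring

end PartialLegendre

section Estimate

variable {F φ : (Fin 5 → ℝ) → ℝ}

/-- Bounds for the coefficients of the linearized equation. -/
theorem EqStar.coefficient_bounds (h : EqStar F φ) (hF : ContDiff ℝ 2 F) (hφ : ContDiff ℝ 4 φ)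
    (hp : PeriodicPi φ) {A B : ℝ} (hA0 : 0 ≤ A) (hA : ∀ x, |F x| ≤ A)
    (hA2 : ∀ k x, |pd2 k k F x| ≤ A) (hB : ∀ x, |φ x| ≤ B) (x : Fin 5 → ℝ) :
    (pd2 4 4 φ x + 1)⁻¹ ≤ ((2 + 5 * A) * Real.exp A + 2 * B) * Real.exp A ∧
      pd2 4 4 φ x + 1 ≤ (2 + 5 * A) * Real.exp A + 2 * B ∧
      ∀ i, |pd2 i 4 φ x| ≤ (2 + 5 * A) * Real.exp A + 2 * B := by
  have hX := h.pos' hφ hp x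
  have hY := h.pos hφ hp x
  have hsum := h.laplacian_le hF hφ hp (fun x => (abs_le.1 (hA x)).2)
    (fun k x => (abs_le.1 (hA2 k x)).1) hA0 hB x
  have hsq := h.mul_sub_sum x
  have hB0 : 0 ≤ B := (abs_nonneg _).trans (hB 0)
  have hL1 : 1 ≤ (2 + 5 * A) * Real.exp A + 2 * B := by
    nlinarith [Real.one_le_exp hA0, mul_nonneg hA0 (Real.exp_pos A).le]
  have e : Real.exp (F x / 2) ^ 2 = Real.exp (F x) := by
    rw [← Real.exp_nat_mul]; congr 1; push_cast; ring
  have he : Real.exp (-A) ≤ Real.exp (F x) := Real.exp_le_exp.2 (abs_le.1 (hA x)).1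
  have hsn : 0 ≤ ∑ i : Fin 4, pd2 i.castSucc 4 φ x ^ 2 := Finset.sum_nonneg fun _ _ => sq_nonneg _
  rw [e] at hsq
  set X := pd2 0 0 φ x + pd2 1 1 φ x + pd2 2 2 φ x + pd2 3 3 φ x + 1
  set Y := pd2 4 4 φ x + 1 with hYdef
  set Λ := (2 + 5 * A) * Real.exp A + 2 * B
  have hXY : X * Y ≤ Λ * Y := mul_le_mul_of_nonneg_right (by linarith) hY.le
  refine ⟨?_, by linarith, fun i => ?_⟩
  · rw [inv_le_iff_one_le_mul₀' hY]
    have h1 : Real.exp (-A) * Real.exp A ≤ Λ * Y * Real.exp A :=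
      mul_le_mul_of_nonneg_right (by linarith) (Real.exp_pos A).le
    rw [← Real.exp_add, neg_add_cancel, Real.exp_zero] at h1
    linarith
  · induction i using Fin.lastCases with
    | last =>
      change |pd2 4 4 φ x| ≤ Λ
      rw [abs_le]
      constructor <;> linarith
    | cast i =>
      refine abs_le_of_sq_le_sq ?_ (by linarith)
      have h1 : pd2 i.castSucc 4 φ x ^ 2 ≤ ∑ i : Fin 4, pd2 i.castSucc 4 φ x ^ 2 :=
        Finset.single_le_sum (f := fun i : Fin 4 => pd2 i.castSucc 4 φ x ^ 2)
          (fun _ _ => sq_nonneg _) (Finset.mem_univ i)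
      nlinarith [Real.exp_pos (F x)]

/-- Hölder estimate for the Hessian of the partial Legendre transform of a solution. -/
theorem EqStar.exists_partialLegendre (h : EqStar F φ) (hF : ContDiff ℝ 2 F) (hφ : ContDiff ℝ 4 φ)
    (hp : PeriodicPi φ) {A D M : ℝ} (hA : ∀ x, |F x| ≤ A) (hA1 : ∀ k x, |pd k F x| ≤ A)
    (hD : ∀ x, (pd2 4 4 φ x + 1)⁻¹ ≤ D) (hM : ∀ i x, |pd2 i 4 φ x| ≤ M) :
    ∃ ψ : (Fin 5 → ℝ) → ℝ, ContDiff ℝ 3 ψ ∧ PeriodicPi ψ ∧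
      HessianIncrementLE ψ (2 * (1090519040 *
        (5 * (Real.exp A * (A + M * D * A)) * D + 1) / Real.exp (-A)) + 1) ∧
      (∀ x, 1 + pd2 4 4 ψ (x + pd 4 φ x • bvec 4) = (pd2 4 4 φ x + 1)⁻¹) ∧
      ∀ i j x, pd2 i j φ x = (pd2 4 4 φ x + 1) * pd2 i 4 ψ (x + pd 4 φ x • bvec 4) *
        pd2 4 j ψ (x + pd 4 φ x • bvec 4) - pd2 i j ψ (x + pd 4 φ x • bvec 4) := by
  have hpos := h.pos hφ hp
  obtain ⟨S, ψ, hS, hST, hchain, hψ, hψp, hψ2⟩ := _root_.exists_partialLegendre hφ hp hpos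
  have hA0 : 0 ≤ A := (abs_nonneg _).trans (hA 0)
  have hD0 : 0 ≤ D := (inv_nonneg.2 (hpos 0).le).trans (hD 0)
  have hM0 : 0 ≤ M := (abs_nonneg _).trans (hM 0 0)
  have hF1 : Differentiable ℝ F := hF.differentiable (by norm_num)
  have hψ44 (z) : 1 + pd2 4 4 ψ z = (pd2 4 4 φ (S z) + 1)⁻¹ := by
    have := (hpos (S z)).ne'
    rw [hψ2]
    field_simp
    ring
  refine ⟨ψ, hψ, hψp, ?_, fun x => by rw [hψ44, hST], fun i j x => ?_⟩
  · set L := Real.exp A * (A + M * D * A) with hL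
    have hL0 : 0 ≤ L := by positivity
    have hlip (m : Fin 5) (z) : |pd m (fun z => Real.exp (F (S z))) z| ≤ L := by
      have hexp (i : Fin 5) (x) : pd i (fun x => Real.exp (F x)) x = Real.exp (F x) * pd i F x := by
        simp only [pd]
        rw [fderiv_exp (hF1 x)]
        simp
      rw [hchain (fun x => Real.exp (F x)) hF1.exp, hexp, hexp]
      have e1 : Real.exp (F (S z)) * pd m F (S z) - pd2 m 4 φ (S z) / (pd2 4 4 φ (S z) + 1) *
          (Real.exp (F (S z)) * pd 4 F (S z)) = Real.exp (F (S z)) *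
          (pd m F (S z) - pd2 m 4 φ (S z) * (pd2 4 4 φ (S z) + 1)⁻¹ * pd 4 F (S z)) := by
        rw [div_eq_mul_inv]; ring
      rw [e1, abs_mul, Real.abs_exp]
      refine mul_le_mul (Real.exp_le_exp.2 (abs_le.1 (hA _)).2) ?_ (abs_nonneg _)
        (Real.exp_pos _).le
      refine (abs_sub _ _).trans (add_le_add (hA1 _ _) ?_)
      rw [abs_mul, abs_mul, abs_of_pos (inv_pos.2 (hpos _))]
      have := inv_pos.2 (hpos (S z))
      gcongr
      exacts [hM _ _, hD _, hA1 _ _]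
    have hlip' (x z) : |Real.exp (F (S x)) - Real.exp (F (S z))| ≤ 5 * (L * ‖z - x‖) := by
      have h1 := abs_sub_le_of_coord (f := fun z => Real.exp (F (S z))) (ω := fun r => L * r)
        (fun r s hrs => mul_le_mul_of_nonneg_left hrs hL0)
        (fun k x r hr => abs_sub_le_of_pd_le
          ((hF1.comp (hS.differentiable (by norm_num))).exp) (hlip k) x hr) x z
      rw [abs_sub_comm]
      exact_mod_cast h1
    refine hessianIncrementLE_of_elliptic hψ hψp
      (c := fun x j => if j = 4 then Real.exp (F (S x)) else 1)
      (b := fun x => 1 - Real.exp (F (S x))) (Real.exp_pos _) (by positivity) (fun x j => ?_)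
      (fun x z => ?_)
    · split_ifs
      · exact Real.exp_le_exp.2 (abs_le.1 (hA _)).1
      · exact Real.exp_le_one_iff.2 (by linarith)
    · have hsum : ∑ j : Fin 5, (if j = 4 then Real.exp (F (S x)) else 1) * pd2 j j ψ z =
          pd2 0 0 ψ z + pd2 1 1 ψ z + pd2 2 2 ψ z + pd2 3 3 ψ z + Real.exp (F (S x)) * pd2 4 4 ψ z := by
        rw [Fin.sum_univ_five]
        simp [Fin.ext_iff]
      have heq : pd2 0 0 ψ z + pd2 1 1 ψ z + pd2 2 2 ψ z + pd2 3 3 ψ z +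
          Real.exp (F (S z)) * (1 + pd2 4 4 ψ z) = 1 := by
        have hs (i : Fin 5) : pd2 i i ψ z =
            pd2 i 4 φ (S z) ^ 2 / (pd2 4 4 φ (S z) + 1) - pd2 i i φ (S z) := by
          rw [hψ2, pd2, pd2, pd_comm (hφ.of_le (by norm_num)) 4 i, ← pow_two]
        rw [hψ44, ← h (S z), hs 0, hs 1, hs 2, hs 3]
        have := (hpos (S z)).ne'
        field_simp
        ring
      have e1 : pd2 0 0 ψ z + pd2 1 1 ψ z + pd2 2 2 ψ z + pd2 3 3 ψ z + Real.exp (F (S x)) * pd2 4 4 ψ z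
          - (1 - Real.exp (F (S x))) =
          (Real.exp (F (S x)) - Real.exp (F (S z))) * (1 + pd2 4 4 ψ z) := by linarith
      simp only [hsum]
      rw [e1, abs_mul, hψ44, abs_of_pos (inv_pos.2 (hpos _))]
      calc _ ≤ 5 * (L * ‖z - x‖) * D :=
            mul_le_mul (hlip' x z) (hD _) (inv_pos.2 (hpos _)).le (by positivity)
        _ ≤ (5 * L * D + 1) * ‖z - x‖ := by linarith [norm_nonneg (z - x)]
  · have := (hpos x).ne'
    rw [hψ2, hψ2, hψ2, hST]
    field_simp
    ring

end Estimate

theorem HessianIncrementLE.abs_sub_le {n : ℕ} {f : (Fin n → ℝ) → ℝ} {N : ℝ} (hN : 0 ≤ N)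
    (h : HessianIncrementLE f N) (i j : Fin n) (x y : Fin n → ℝ) :
    |pd2 i j f y - pd2 i j f x| ≤ n * (N * √‖y - x‖) :=
  abs_sub_le_of_coord (ω := fun r => N * √r)
    (fun _ _ hrs => mul_le_mul_of_nonneg_left (Real.sqrt_le_sqrt hrs) hN)
    (fun m x r hr => h i j m x r hr) x y

theorem HessianIncrementLE.abs_le {n : ℕ} {f : (Fin n → ℝ) → ℝ} (hf : ContDiff ℝ 2 f)
    (hp : PeriodicPi f) {N : ℝ} (hN : 0 ≤ N) (h : HessianIncrementLE f N) (i j : Fin n)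
    (x : Fin n → ℝ) : |pd2 i j f x| ≤ N := by
  obtain ⟨τ, hτ, h0⟩ := (hp.pd j).exists_pd_eq_zero
    ((contDiff_pd (m' := 1) hf j (by norm_num)).differentiable (by norm_num)) i x
  have h1 := h i j i x τ hτ.1.le
  rw [pd2, h0, zero_sub, abs_neg] at h1
  exact h1.trans (mul_le_of_le_one_right hN (Real.sqrt_le_one.2 hτ.2.le))

theorem PeriodicPi.abs_pd_le {n : ℕ} {f : (Fin n → ℝ) → ℝ} (hp : PeriodicPi f)
    (hf : ContDiff ℝ 2 f) {i : Fin n} {C : ℝ} (hC : ∀ x, |pd2 i i f x| ≤ C) (x : Fin n → ℝ) :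
    |pd i f x| ≤ C := by
  obtain ⟨τ, hτ, h0⟩ := hp.exists_pd_eq_zero (hf.differentiable (by norm_num)) i x
  have h1 := abs_sub_le_of_pd_le
    ((contDiff_pd (m' := 1) hf i (by norm_num)).differentiable (by norm_num)) hC x hτ.1.le
  rw [h0, zero_sub, abs_neg] at h1
  exact h1.trans (mul_le_of_le_one_right ((abs_nonneg _).trans (hC x)) hτ.2.le)

/-- The Hessian of a solution is controlled by the one of its partial Legendre transform. -/
theorem hessian_estimate_of_partialLegendre {n : ℕ} {f ψ : (Fin n → ℝ) → ℝ} {k : Fin n} {M N : ℝ}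
    (hf : ContDiff ℝ 2 f) (hψ : ContDiff ℝ 2 ψ) (hψp : PeriodicPi ψ) (hN : 0 ≤ N)
    (h : HessianIncrementLE ψ N) (hpos : ∀ x, 0 < pd2 k k f x + 1)
    (hY : ∀ x, pd2 k k f x + 1 ≤ M) (hM : ∀ i x, |pd2 i k f x| ≤ M)
    (hkk : ∀ x, 1 + pd2 k k ψ (x + pd k f x • bvec k) = (pd2 k k f x + 1)⁻¹)
    (hij : ∀ i j x, pd2 i j f x = (pd2 k k f x + 1) * pd2 i k ψ (x + pd k f x • bvec k) *
        pd2 k j ψ (x + pd k f x • bvec k) - pd2 i j ψ (x + pd k f x • bvec k)) (i j : Fin n) :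
    (∀ x, |pd2 i j f x| ≤ M * N * N + N) ∧ ∀ x y, |pd2 i j f y - pd2 i j f x| ≤
      (n * (N * √(1 + n * M)) * (M ^ 2 * N ^ 2 + 2 * M * N + 1)) * √‖y - x‖ := by
  have hM0 : 0 ≤ M := (abs_nonneg _).trans (hM k 0)
  have hNψ (i j x) : |pd2 i j ψ x| ≤ N := h.abs_le hψ hψp hN i j x
  have hYa (x) : |pd2 k k f x + 1| ≤ M := by rw [abs_of_pos (hpos x)]; exact hY x
  refine ⟨fun x => ?_, fun x y => ?_⟩
  · rw [hij]
    refine (abs_sub _ _).trans (add_le_add ?_ (hNψ _ _ _))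
    rw [abs_mul, abs_mul]
    gcongr
    exacts [hYa _, hNψ _ _ _, hNψ _ _ _]
  · set T := fun x => x + pd k f x • bvec k with hT
    set ρ := √‖y - x‖
    have hTlip : ‖T y - T x‖ ≤ (1 + n * M) * ‖y - x‖ := by
      have h1 := abs_sub_le_of_coord (f := pd k f) (ω := fun r => M * r)
        (fun r s hrs => mul_le_mul_of_nonneg_left hrs hM0)
        (fun m x r hr => abs_sub_le_of_pd_le
          ((contDiff_pd (m' := 1) hf k (by norm_num)).differentiable (by norm_num))
          (fun x => hM m x) x hr) x y
      have e : T y - T x = (y - x) + (pd k f y - pd k f x) • bvec k := by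
        simp only [hT]; module
      rw [e]
      refine (norm_add_le _ _).trans ?_
      rw [norm_smul, Pi.norm_single, norm_one, mul_one, Real.norm_eq_abs]
      linarith
    set G := n * (N * √(1 + n * M)) with hG
    have hG0 : 0 ≤ G := by positivity
    have hρ : 0 ≤ ρ := Real.sqrt_nonneg _
    have hψT (i j) : |pd2 i j ψ (T y) - pd2 i j ψ (T x)| ≤ G * ρ := by
      refine (h.abs_sub_le hN i j _ _).trans ?_
      have h2 : √‖T y - T x‖ ≤ √(1 + n * M) * ρ := by
        rw [← Real.sqrt_mul (by positivity)]
        exact Real.sqrt_le_sqrt hTlip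
      calc _ ≤ n * (N * (√(1 + n * M) * ρ)) := by gcongr
        _ = G * ρ := by rw [hG]; ring
    have hYT : |(pd2 k k f y + 1) - (pd2 k k f x + 1)| ≤ M * M * (G * ρ) := by
      have e : (pd2 k k f y + 1) - (pd2 k k f x + 1) = (pd2 k k f y + 1) * (pd2 k k f x + 1) *
          -(pd2 k k ψ (T y) - pd2 k k ψ (T x)) := by
        have h1 := hkk x
        have h2 := hkk y
        have e2 : pd2 k k ψ (T y) - pd2 k k ψ (T x) =
          (pd2 k k f y + 1)⁻¹ - (pd2 k k f x + 1)⁻¹ := by rw [← h1, ← h2]; simp only [hT]; ring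
        rw [e2]
        have := (hpos x).ne'
        have := (hpos y).ne'
        field_simp
        ring
      rw [e, abs_mul, abs_mul, abs_neg]
      gcongr
      exacts [hYa _, hYa _, hψT _ _]
    have e : pd2 i j f y - pd2 i j f x =
        ((pd2 k k f y + 1) - (pd2 k k f x + 1)) * pd2 i k ψ (T y) * pd2 k j ψ (T y) +
        (pd2 k k f x + 1) * (pd2 i k ψ (T y) - pd2 i k ψ (T x)) * pd2 k j ψ (T y) +
        (pd2 k k f x + 1) * pd2 i k ψ (T x) * (pd2 k j ψ (T y) - pd2 k j ψ (T x)) -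
        (pd2 i j ψ (T y) - pd2 i j ψ (T x)) := by
      rw [hij i j y, hij i j x]; ring
    calc |pd2 i j f y - pd2 i j f x|
        ≤ M * M * (G * ρ) * N * N + M * (G * ρ) * N + M * N * (G * ρ) + G * ρ := by
          rw [e]
          refine (abs_sub _ _).trans (add_le_add ((abs_add_three _ _ _).trans
            (add_le_add (add_le_add ?_ ?_) ?_)) (hψT _ _))
          all_goals
            rw [abs_mul, abs_mul]
            gcongr
            all_goals first | exact hYT | exact hYa _ | exact hψT _ _ | exact hNψ _ _ _
      _ = _ := by ring

/-- A function with Hölder continuous second derivatives has bounded `C^{2,α}`-norm. -/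
theorem CAlphaNorm_two_le {n : ℕ} {f : (Fin n → ℝ) → ℝ} (hf : ContDiff ℝ 2 f) (hp : PeriodicPi f)
    {B P H : ℝ} (hP : 0 ≤ P) (hH : 0 ≤ H) (hB : ∀ x, |f x| ≤ B)
    (h2 : ∀ i j x, |pd2 i j f x| ≤ P)
    (h3 : ∀ i j x y, |pd2 i j f y - pd2 i j f x| ≤ H * √‖y - x‖) :
    CAlphaNorm 2 (1 / 2) f ≤ B + P + H := by
  have hB0 : 0 ≤ B := (abs_nonneg _).trans (hB 0)
  refine max_le (CNorm_le (by positivity) fun l hl x => ?_)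
    (holderSemi_le (by positivity) fun l hl x y hy => ?_)
  · match l, hl with
    | [], _ => exact (hB x).trans (by linarith)
    | [i], _ => exact (hp.abs_pd_le hf (fun x => h2 i i x) x).trans (by linarith)
    | [i, j], _ => exact (h2 i j x).trans (by linarith)
  · match l, hl with
    | [i, j], _ =>
      rw [← Real.sqrt_eq_rpow]
      refine (h3 i j x (x + y)).trans ?_
      rw [add_sub_cancel_left]
      gcongr
      · linarith
      · exact norm_le_eucNorm y

theorem exists_C2alpha_bound (A B : ℝ) : ∃ C : ℝ, ∀ F φ : (Fin 5 → ℝ) → ℝ,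
    ContDiff ℝ 2 F → PeriodicPi F → ContDiff ℝ 4 φ → PeriodicPi φ → EqStar F φ →
    CNorm 2 F = A → CNorm 0 φ = B → CAlphaNorm 2 (1 / 2) φ ≤ C := by
  set M := (2 + 5 * A) * Real.exp A + 2 * B with hMdef
  set D := M * Real.exp A with hDdef
  set N := 2 * (1090519040 * (5 * (Real.exp A * (A + M * D * A)) * D + 1) / Real.exp (-A)) + 1
    with hNdef
  refine ⟨B + (M * N * N + N) +
    (5 * (N * √(1 + 5 * M)) * (M ^ 2 * N ^ 2 + 2 * M * N + 1)), ?_⟩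
  intro F φ hF hFp hφ hp h hFA hφB
  have hA (x) : |F x| ≤ A := by
    simpa [pdI_zero, hFA] using abs_pdI_le_CNorm (I := 0) hF hFp (by simp) x
  have hA1 (k x) : |pd k F x| ≤ A := by
    simpa [pdI_single, hFA] using abs_pdI_le_CNorm (I := Pi.single k 1) hF hFp (by simp) x
  have hA2 (k x) : |pd2 k k F x| ≤ A := by
    simpa [pdI_single, hFA, pd2] using abs_pdI_le_CNorm (I := Pi.single k 2) hF hFp (by simp) x
  have hB (x) : |φ x| ≤ B := by
    simpa [pdI_zero, hφB] using abs_pdI_le_CNorm (k := 0) (I := 0) (hφ.of_le (by norm_num)) hp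
      (by simp) x
  have hA0 : 0 ≤ A := (abs_nonneg _).trans (hA 0)
  have hbd := h.coefficient_bounds hF hφ hp hA0 hA hA2 hB
  have hB0 : 0 ≤ B := (abs_nonneg _).trans (hB 0)
  have hM0 : 0 ≤ M := by positivity
  have hN0 : 0 ≤ N := by positivity
  obtain ⟨ψ, hψ, hψp, hinc, hkk, hij⟩ := h.exists_partialLegendre hF hφ hp hA hA1
    (fun x => (hbd x).1) (fun i x => (hbd x).2.2 i)
  have hest := hessian_estimate_of_partialLegendre (hφ.of_le (by norm_num))
    (hψ.of_le (by norm_num)) hψp hN0 hinc (h.pos hφ hp) (fun x => (hbd x).2.1)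
    (fun i x => (hbd x).2.2 i) hkk hij
  exact CAlphaNorm_two_le (hφ.of_le (by norm_num)) hp (by positivity) (by positivity) hB
    (fun i j => (hest i j).1) (fun i j => by exact_mod_cast (hest i j).2)

/-- A priori `C^{2,α}`-estimate for solutions of the quaternionic Monge–Ampère
equation on `T⁵`. -/
theorem C2alpha_estimate :
    ∃ α ∈ Set.Ioo (0:ℝ) 1, ∃ C₄ : ℝ → ℝ → ℝ,
      ∀ F φ : (Fin 5 → ℝ) → ℝ,
        ContDiff ℝ 2 F → PeriodicPi F →
        (∫ x in Set.Icc (0 : Fin 5 → ℝ) 1, (Real.exp (F x) - 1) = 0) →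
        ContDiff ℝ 4 φ → PeriodicPi φ →
        (∫ x in Set.Icc ((fun _ => -(1/2)) : Fin 5 → ℝ) (fun _ => 1/2), φ x) = 0 →
        EqStar F φ →
        CAlphaNorm 2 α φ ≤ C₄ (CNorm 2 F) (CNorm 0 φ) := by
  choose C hC using exists_C2alpha_bound
  exact ⟨1 / 2, by norm_num, C, fun F φ hF hFp _ hφ hp _ h =>
    hC _ _ F φ hF hFp hφ hp h rfl rfl⟩
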